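/- Let X be a finitely generated FI-set and let E be a symmetric FI-subset of X × X (i.e., (x,y) ∈ E_n if and only if (y,x) ∈ E_n), and let r_n : ℝX_n → ℝX_n be either the adjacency operator r_n(e_x) = Σ_{(x,y)∈E_n} e_y, or the Laplacian r_n = D_n − A_n, where A_n is the adjacency operator and D_n is the diagonal operator D_n(e_x) = (#{y : (x,y) ∈ E_n})·e_x. Since r_n is symmetric, its eigenvalues are real; write the distinct eigenvalues of r_n as λ_1(n) < λ_2(n) < … < λ_{l(n)}(n). Then there exists n₀ such that for all n ≥ n₀: (1) l(n) equals a constant l; (2) for each 1 ≤ i ≤ l there is a nonzero polynomial P_i ∈ ℚ[t][z] with P_i(n, λ_i(n)) = 0 for all n ≥ n₀; and (3) for each i the multiplicity of λ_i(n) as an eigenvalue of r_n agrees with a polynomial in n. -/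

import Mathlib

/-- The category `FI` has objects `[n] = {1, …, n}` and morphisms the injections.
An `FI`-set is a functor from `FI` to the category of finite sets.  We record it by
its values `obj n` (for the object `[n]`, modelled as `Fin n`) together with the
maps induced by injections, subject to functoriality. -/
structure FISet where
  obj : ℕ → Type
  map : ∀ {m n : ℕ}, (Fin m ↪ Fin n) → obj m → obj n
  map_id : ∀ (n : ℕ) (x : obj n), map (Function.Embedding.refl (Fin n)) x = x
  map_comp : ∀ {m n p : ℕ} (f : Fin m ↪ Fin n) (g : Fin n ↪ Fin p) (x : obj m),
      map (f.trans g) x = map g (map f x)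
  finite : ∀ n, Finite (obj n)

attribute [instance] FISet.finite

noncomputable instance (X : FISet) (n : ℕ) : Fintype (X.obj n) := Fintype.ofFinite _

/-- Since `End_FI([n]) = S_n`, each `X_n` is an `S_n`-set. -/
instance FISet.instMulAction (X : FISet) (n : ℕ) : MulAction (Equiv.Perm (Fin n)) (X.obj n) where
  smul σ x := X.map σ.toEmbedding x
  one_smul x := by
    have h : (1 : Equiv.Perm (Fin n)).toEmbedding = Function.Embedding.refl (Fin n) := by
      ext i; rfl
    show X.map (1 : Equiv.Perm (Fin n)).toEmbedding x = x
    rw [h]; exact X.map_id n x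
  mul_smul σ τ x := by
    have h : (σ * τ).toEmbedding = (τ.toEmbedding.trans σ.toEmbedding) := by ext i; rfl
    show X.map (σ * τ).toEmbedding x = X.map σ.toEmbedding (X.map τ.toEmbedding x)
    rw [h]; exact X.map_comp _ _ _

theorem FISet.smul_def (X : FISet) {n : ℕ} (σ : Equiv.Perm (Fin n)) (x : X.obj n) :
    σ • x = X.map σ.toEmbedding x := rfl

/-- An `FI`-set is finitely generated in degree `≤ d` if every element of every `X_n` is in
the image of a transition map from some `X_m` with `m ≤ d`. -/
def FISet.FGDeg (X : FISet) (d : ℕ) : Prop :=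
  ∀ (n : ℕ) (x : X.obj n), ∃ (m : ℕ) (_ : m ≤ d) (f : Fin m ↪ Fin n) (y : X.obj m),
    X.map f y = x

/-- An `FI`-set is finitely generated if it is finitely generated in some degree. -/
def FISet.FG (X : FISet) : Prop := ∃ d, X.FGDeg d

/-- The product of two `FI`-sets, `(X × Y)_n = X_n × Y_n` with the diagonal transition maps. -/
def FISet.prod (X Y : FISet) : FISet where
  obj n := X.obj n × Y.obj n
  map f z := (X.map f z.1, Y.map f z.2)
  map_id n z := by simp [X.map_id, Y.map_id]
  map_comp f g z := by simp [X.map_comp, Y.map_comp]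
  finite n := by infer_instance

/-- An `FI`-subset of an `FI`-set `X` is a family of subsets `R n ⊆ X_n` carried into one
another by all the transition maps. -/
def FISet.IsFISubset (X : FISet) (R : ∀ n, Set (X.obj n)) : Prop :=
  ∀ {m n : ℕ} (f : Fin m ↪ Fin n), ∀ x ∈ R m, X.map f x ∈ R n

/-- The sub-`FI`-set determined by an `FI`-subset. -/
def FISet.subFISet (X : FISet) (R : ∀ n, Set (X.obj n)) (hR : X.IsFISubset R) : FISet where
  obj n := ↥(R n)
  map f x := ⟨X.map f x.1, hR f x.1 x.2⟩
  map_id n x := by simp [Subtype.ext_iff, X.map_id]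
  map_comp f g x := by simp [Subtype.ext_iff, X.map_comp]
  finite n := by infer_instance
open scoped Classical in
/-- The adjacency operator `A_n : ℝX_n → ℝX_n` of the edge relation,
`A_n(e_x) = Σ_{(x,y) ∈ E_n} e_y`. -/
noncomputable def adjEnd (X : FISet) (E : ∀ n, Set ((X.prod X).obj n)) (n : ℕ) :
    Module.End ℝ (X.obj n → ℝ) :=
  Matrix.toLin' (fun y x => if (x, y) ∈ E n then (1 : ℝ) else 0)

open scoped Classical in
/-- The diagonal degree operator `D_n : ℝX_n → ℝX_n`,
`D_n(e_x) = #{y : (x,y) ∈ E_n} • e_x`. -/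
noncomputable def degEnd (X : FISet) (E : ∀ n, Set ((X.prod X).obj n)) (n : ℕ) :
    Module.End ℝ (X.obj n → ℝ) :=
  Matrix.toLin' (Matrix.diagonal (fun x => (Nat.card {y : X.obj n | (x, y) ∈ E n} : ℝ)))


namespace S15
open Polynomial Filter Topology

/-- evaluation of a polynomial with rational coefficients as real function -/
noncomputable def phi : ℚ[X] →+* (ℝ → ℝ) := (Polynomial.aeval (fun t : ℝ => t) : ℚ[X] →ₐ[ℚ] (ℝ → ℝ)).toRingHom

theorem phi_apply (p : ℚ[X]) (t : ℝ) : phi p t = Polynomial.aeval t p := by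
  have := Polynomial.hom_eval₂ p (algebraMap ℚ (ℝ → ℝ)) (Pi.evalRingHom (fun _ : ℝ => ℝ) t) (fun t : ℝ => t)
  exact this

/-- two variable evaluation -/
noncomputable def ev2 (t : ℝ) (z : ℝ) (P : ℚ[X][X]) : ℝ :=
  Polynomial.eval₂ (Polynomial.aeval t : ℚ[X] →ₐ[ℚ] ℝ).toRingHom z P

noncomputable instance germAlg : Algebra ℚ[X] (Germ (atTop : Filter ℝ) ℝ) :=
  ((Germ.coeRingHom (atTop : Filter ℝ)).comp phi).toAlgebra

theorem alg_iff (f : ℝ → ℝ) : IsAlgebraic ℚ[X] (f : Germ (atTop : Filter ℝ) ℝ) ↔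
    ∃ P : ℚ[X][X], P ≠ 0 ∧ ∀ᶠ t in atTop, ev2 t (f t) P = 0 := by
  have key : ∀ P : ℚ[X][X], Polynomial.aeval (f : Germ (atTop : Filter ℝ) ℝ) P
      = ((fun t => ev2 t (f t) P : ℝ → ℝ) : Germ (atTop : Filter ℝ) ℝ) := by
    intro P
    have h1 := Polynomial.hom_eval₂ P phi (Germ.coeRingHom (atTop : Filter ℝ)) f
    have h2 : ∀ t, Polynomial.eval₂ phi f P t = ev2 t (f t) P := by
      intro t
      have := Polynomial.hom_eval₂ P phi (Pi.evalRingHom (fun _ : ℝ => ℝ) t) f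
      refine this.trans ?_
      unfold ev2
      congr 1
      ext p
      · simp
      · simp [phi_apply]
    have h3 : Polynomial.eval₂ phi f P = fun t => ev2 t (f t) P := funext h2
    rw [← h3]
    exact h1.symm
  constructor
  · rintro ⟨P, hP, h⟩
    refine ⟨P, hP, ?_⟩
    rw [key] at h
    exact Germ.coe_eq.1 h
  · rintro ⟨P, hP, h⟩
    refine ⟨P, hP, ?_⟩
    rw [key]
    exact Germ.coe_eq.2 h

/-- The Hardy-type ring -/
noncomputable def H : Subring (ℝ → ℝ) where
  carrier := {f | (∃ a, ContinuousOn f (Set.Ioi a)) ∧ IsAlgebraic ℚ[X] (f : Germ (atTop : Filter ℝ) ℝ)}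
  mul_mem' := by
    rintro f g ⟨⟨a, ha⟩, hf⟩ ⟨⟨b, hb⟩, hg⟩
    refine ⟨⟨max a b, ContinuousOn.mul (ha.mono ?_) (hb.mono ?_)⟩, ?_⟩
    · exact Set.Ioi_subset_Ioi (le_max_left _ _)
    · exact Set.Ioi_subset_Ioi (le_max_right _ _)
    · exact hf.mul hg
  add_mem' := by
    rintro f g ⟨⟨a, ha⟩, hf⟩ ⟨⟨b, hb⟩, hg⟩
    refine ⟨⟨max a b, ContinuousOn.add (ha.mono ?_) (hb.mono ?_)⟩, ?_⟩
    · exact Set.Ioi_subset_Ioi (le_max_left _ _)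
    · exact Set.Ioi_subset_Ioi (le_max_right _ _)
    · exact hf.add hg
  one_mem' := ⟨⟨0, continuousOn_const⟩, isAlgebraic_one⟩
  zero_mem' := ⟨⟨0, continuousOn_const⟩, isAlgebraic_zero⟩
  neg_mem' := by
    rintro f ⟨⟨a, ha⟩, hf⟩
    exact ⟨⟨a, ha.neg⟩, hf.neg⟩

theorem mem_H {f : ℝ → ℝ} : f ∈ H ↔ (∃ a, ContinuousOn f (Set.Ioi a)) ∧
    IsAlgebraic ℚ[X] (f : Germ (atTop : Filter ℝ) ℝ) := Iff.rfl

theorem phi_mem (p : ℚ[X]) : phi p ∈ H := by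
  refine ⟨⟨0, ?_⟩, ?_⟩
  · have : phi p = fun t => Polynomial.aeval t p := funext (phi_apply p)
    rw [this]
    exact (Polynomial.continuous_aeval p).continuousOn
  · exact isAlgebraic_algebraMap (R := ℚ[X]) (A := Germ (atTop : Filter ℝ) ℝ) p

theorem id_mem : (fun t : ℝ => t) ∈ H := by
  have := phi_mem X
  have h : phi X = fun t : ℝ => t := by ext t; simp [phi_apply]
  rwa [h] at this

theorem const_mem (q : ℚ) : (fun _ : ℝ => (q : ℝ)) ∈ H := by
  have := phi_mem (C q)
  have h : phi (C q) = fun t : ℝ => (q : ℝ) := by ext t; simp [phi_apply]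
  rwa [h] at this

theorem aeval_ne {p : ℚ[X]} (hp : p ≠ 0) : ∀ᶠ t : ℝ in atTop, Polynomial.aeval t p ≠ 0 := by
  have h1 : p.map (algebraMap ℚ ℝ) ≠ 0 := by
    rwa [Ne, Polynomial.map_eq_zero]
  have h2 := Polynomial.eventually_atTop_not_isRoot _ h1
  filter_upwards [h2] with t ht h
  apply ht
  rw [Polynomial.IsRoot, Polynomial.eval_map_algebraMap, h]

theorem phi_ev_ne {p : ℚ[X]} (hp : p ≠ 0) : ∀ᶠ t : ℝ in atTop, phi p t ≠ 0 := by
  simpa [phi_apply] using aeval_ne hp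

theorem shift_mem {f : ℝ → ℝ} (hf : f ∈ H) : (fun t => f (t + 1)) ∈ H := by
  obtain ⟨⟨a, ha⟩, hf⟩ := hf
  refine ⟨⟨a, ?_⟩, ?_⟩
  · refine ha.comp (by fun_prop) ?_
    intro t ht
    simp only [Set.mem_Ioi] at *
    linarith
  · rw [alg_iff] at hf ⊢
    obtain ⟨P, hP, h⟩ := hf
    let s : ℚ[X] →+* ℚ[X] := (Polynomial.aeval (X + 1 : ℚ[X]) : ℚ[X] →ₐ[ℚ] ℚ[X]).toRingHom
    have hs : Function.Injective s := by
      intro p q hpq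
      have : (p.comp (X + C 1)) = q.comp (X + C 1) := by
        simpa [s, Polynomial.comp, Polynomial.aeval_def] using hpq
      have h2 := congrArg (fun r => r.comp (X - C 1)) this
      simpa [Polynomial.comp_assoc] using h2
    refine ⟨P.map s, ?_, ?_⟩
    · rwa [Ne, Polynomial.map_eq_zero_iff hs]
    · have := (tendsto_atTop_add_const_right atTop (1 : ℝ) tendsto_id).eventually h
      filter_upwards [this] with t ht
      unfold ev2 at *
      rw [Polynomial.eval₂_map]
      refine Eq.trans ?_ ht
      congr 1
      ext p
      · simp
      · simp [s]

/-- zero-or-nonzero dichotomy -/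
theorem dich {f : ℝ → ℝ} (hf : f ∈ H) : (∀ᶠ t in atTop, f t = 0) ∨
    ((∀ᶠ t in atTop, 0 < f t) ∨ (∀ᶠ t in atTop, f t < 0)) := by
  obtain ⟨⟨a, ha⟩, hf⟩ := hf
  rw [alg_iff] at hf
  obtain ⟨P, hP, h⟩ := hf
  obtain ⟨Q, hQ, hd⟩ := Polynomial.exists_eq_pow_rootMultiplicity_mul_and_not_dvd P hP 0
  rw [map_zero, sub_zero] at hQ hd
  rw [Polynomial.X_dvd_iff] at hd
  have h0 := aeval_ne hd
  obtain ⟨b, hb⟩ := (h.and h0).exists_forall_of_atTop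
  set c := max a b
  have hc : ContinuousOn f (Set.Ioi c) := ha.mono (Set.Ioi_subset_Ioi (le_max_left _ _))
  have hc1 : ∀ t ∈ Set.Ioi c, f t = 0 ∨ ev2 t (f t) Q = 0 := by
    intro t ht
    have := (hb t ((le_max_right _ _).trans (le_of_lt ht))).1
    unfold ev2 at *
    rw [hQ, Polynomial.eval₂_mul, Polynomial.eval₂_pow, Polynomial.eval₂_X] at this
    rcases mul_eq_zero.1 this with h | h
    · exact Or.inl (eq_zero_of_pow_eq_zero h)
    · exact Or.inr h
  have hc2 : ∀ t ∈ Set.Ioi c, f t = 0 → ev2 t (f t) Q ≠ 0 := by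
    intro t ht h
    have := (hb t ((le_max_right _ _).trans (le_of_lt ht))).2
    unfold ev2
    rw [h, Polynomial.eval₂_at_zero]
    exact this
  have hQc : ContinuousOn (fun t => ev2 t (f t) Q) (Set.Ioi c) := by
    unfold ev2
    simp only [Polynomial.eval₂_eq_sum_range]
    refine continuousOn_finsetSum _ fun i _ => ContinuousOn.mul ?_ (hc.pow i)
    exact (Polynomial.continuous_aeval _).continuousOn
  have hg := continuousOn_iff_continuous_domRestrict.1 hc
  have hq := continuousOn_iff_continuous_domRestrict.1 hQc
  have : PreconnectedSpace (Set.Ioi c) :=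
    isPreconnected_iff_preconnectedSpace.1 isPreconnected_Ioi
  have hclop : IsClopen {t : Set.Ioi c | f t = 0} := by
    refine ⟨isClosed_eq hg continuous_const, ?_⟩
    have : {t : Set.Ioi c | f t = 0} = {t : Set.Ioi c | ev2 t (f t) Q ≠ 0} := by
      ext ⟨t, ht⟩
      simp only [Set.mem_ofPred_eq]
      exact ⟨hc2 t ht, fun h => (hc1 t ht).resolve_right h⟩
    rw [this]
    exact (isClosed_eq hq continuous_const).isOpen_compl
  rcases isClopen_iff.1 hclop with he | he
  · right
    have hne : ∀ t ∈ Set.Ioi c, f t ≠ 0 := by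
      intro t ht h
      have : (⟨t, ht⟩ : Set.Ioi c) ∈ {t : Set.Ioi c | f t = 0} := h
      rw [he] at this
      exact this
    by_cases hp : 0 < f (c + 1)
    · left
      filter_upwards [eventually_gt_atTop c] with t ht
      by_contra hn
      obtain ⟨x, hx, hx0⟩ := isPreconnected_Ioi.intermediate_value (show t ∈ Set.Ioi c from ht)
        (show c + 1 ∈ Set.Ioi c by simp) hc (show (0 : ℝ) ∈ Set.Icc (f t) (f (c+1)) from
          ⟨not_lt.1 hn, hp.le⟩)
      exact hne x hx hx0
    · right
      filter_upwards [eventually_gt_atTop c] with t ht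
      by_contra hn
      obtain ⟨x, hx, hx0⟩ := isPreconnected_Ioi.intermediate_value
        (show c + 1 ∈ Set.Ioi c by simp) (show t ∈ Set.Ioi c from ht) hc
        (show (0 : ℝ) ∈ Set.Icc (f (c+1)) (f t) from ⟨not_lt.1 hp, not_lt.1 hn⟩)
      exact hne x hx hx0
  · left
    filter_upwards [eventually_gt_atTop c] with t ht
    have : (⟨t, ht⟩ : Set.Ioi c) ∈ {t : Set.Ioi c | f t = 0} := by rw [he]; trivial
    exact this

theorem dich' {f : ℝ → ℝ} (hf : f ∈ H) : (∀ᶠ t in atTop, f t = 0) ∨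
    (∀ᶠ t in atTop, f t ≠ 0) := by
  rcases dich hf with h | h | h
  · exact Or.inl h
  · exact Or.inr (h.mono fun _ h => h.ne')
  · exact Or.inr (h.mono fun _ h => h.ne)

theorem inv_mem {f : ℝ → ℝ} (hf : f ∈ H) (hne : ∀ᶠ t in atTop, f t ≠ 0) : f⁻¹ ∈ H := by
  obtain ⟨⟨a, ha⟩, hf⟩ := hf
  obtain ⟨b, hb⟩ := hne.exists_forall_of_atTop
  refine ⟨⟨max a b, ?_⟩, ?_⟩
  · refine (ha.mono (Set.Ioi_subset_Ioi (le_max_left _ _))).inv₀ ?_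
    intro t ht
    exact hb t ((le_max_right _ _).trans (le_of_lt ht))
  · have h1 : (f : Germ (atTop : Filter ℝ) ℝ) * ((f⁻¹ : ℝ → ℝ) : Germ (atTop : Filter ℝ) ℝ) = 1 := by
      refine Germ.coe_eq.2 ?_
      filter_upwards [hne] with t ht
      exact mul_inv_cancel₀ ht
    refine IsAlgebraic.of_mul (y := (f : Germ (atTop : Filter ℝ) ℝ)) ?_ hf ?_
    · exact (IsUnit.of_mul_eq_one _ h1).mem_nonZeroDivisors
    · rw [h1]; exact isAlgebraic_one

theorem div_mem {f g : ℝ → ℝ} (hf : f ∈ H) (hg : g ∈ H) (hne : ∀ᶠ t in atTop, g t ≠ 0) :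
    f / g ∈ H := by
  rw [div_eq_mul_inv]
  exact H.mul_mem hf (inv_mem hg hne)

theorem congr_mem {f g : ℝ → ℝ} (hf : f ∈ H) (h : ∀ᶠ t in atTop, f t = g t) : g ∈ H := by
  obtain ⟨⟨a, ha⟩, hf⟩ := hf
  obtain ⟨b, hb⟩ := h.exists_forall_of_atTop
  refine ⟨⟨max a b, ?_⟩, ?_⟩
  · refine (ha.mono (Set.Ioi_subset_Ioi (le_max_left _ _))).congr ?_
    intro t ht
    exact (hb t ((le_max_right _ _).trans (le_of_lt ht))).symm
  · have : (f : Germ (atTop : Filter ℝ) ℝ) = g := Germ.coe_eq.2 h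
    rwa [← this]

/-- germs of elements of H -/
noncomputable def HG : Subalgebra ℚ[X] (Germ (atTop : Filter ℝ) ℝ) where
  toSubsemiring := (H.map (Germ.coeRingHom (atTop : Filter ℝ))).toSubsemiring
  algebraMap_mem' := fun p => ⟨phi p, phi_mem p, rfl⟩

instance : NoZeroDivisors HG where
  eq_zero_or_eq_zero_of_mul_eq_zero := by
    rintro ⟨_, f, hf, rfl⟩ ⟨_, g, hg, rfl⟩ h
    have h2 : ((f * g : ℝ → ℝ) : Germ (atTop : Filter ℝ) ℝ) = ((0 : ℝ → ℝ) : Germ (atTop : Filter ℝ) ℝ) :=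
      congrArg Subtype.val h
    have h3 := Germ.coe_eq.1 h2
    rcases dich' hf with h4 | h4
    · left
      exact Subtype.ext (Germ.coe_eq.2 h4)
    · right
      refine Subtype.ext (Germ.coe_eq.2 ?_)
      filter_upwards [h3, h4] with t h5 h6
      exact (mul_eq_zero.1 h5).resolve_left h6

instance : Algebra.IsAlgebraic ℚ[X] HG where
  isAlgebraic := by
    rintro ⟨_, f, hf, rfl⟩
    exact (isAlgebraic_algebraMap_iff (R := ℚ[X]) (S := HG) (A := Germ (atTop : Filter ℝ) ℝ)
      Subtype.val_injective).1 hf.2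

/-- Roots of monic polynomials over H are algebraic. -/
theorem root_alg (p : Polynomial H) (hp : p.Monic) (f : ℝ → ℝ)
    (h : ∀ᶠ t in atTop, (p.map ((Pi.evalRingHom (fun _ : ℝ => ℝ) t).comp H.subtype)).eval (f t) = 0) :
    IsAlgebraic ℚ[X] (f : Germ (atTop : Filter ℝ) ℝ) := by
  refine IsIntegral.trans_isAlgebraic (S := HG) ℚ[X] ?_
  let j : H →+* HG := ((Germ.coeRingHom (atTop : Filter ℝ)).comp H.subtype).codRestrict HG.toSubring
      (fun x => ⟨x.1, x.2, rfl⟩)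
  refine ⟨p.map j, hp.map j, ?_⟩
  rw [Polynomial.eval₂_map]
  have h1 := Polynomial.hom_eval₂ p H.subtype (Germ.coeRingHom (atTop : Filter ℝ)) f
  have h2 : ((algebraMap HG (Germ (atTop : Filter ℝ) ℝ)).comp j) =
    (Germ.coeRingHom (atTop : Filter ℝ)).comp H.subtype := rfl
  rw [h2]
  refine h1.symm.trans (Germ.coe_eq.2 ?_)
  filter_upwards [h] with t ht
  rw [Polynomial.eval_map] at ht
  have h3 := Polynomial.hom_eval₂ p H.subtype (Pi.evalRingHom (fun _ : ℝ => ℝ) t) f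
  exact h3.trans ht

end S15


namespace S15
open Polynomial Filter Topology

theorem natTop {p : ℝ → Prop} (h : ∀ᶠ t in atTop, p t) : ∀ᶠ n : ℕ in atTop, p n :=
  tendsto_natCast_atTop_atTop.eventually h

theorem antidiff (q : ℚ[X]) : ∃ Q : ℚ[X], ∀ x : ℚ, Q.eval (x + 1) - Q.eval x = q.eval x := by
  induction q using Polynomial.induction_on' with
  | add p q hp hq =>
    obtain ⟨P, hP⟩ := hp
    obtain ⟨Q, hQ⟩ := hq
    refine ⟨P + Q, fun x => ?_⟩
    simp only [eval_add]
    rw [← hP, ← hQ]; ring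
  | monomial n a =>
    refine ⟨C (a / (n + 1)) * Polynomial.bernoulli (n + 1), fun x => ?_⟩
    have := Polynomial.bernoulli_eval_one_add (n + 1) x
    simp only [eval_mul, eval_C, eval_monomial]
    rw [add_comm x 1, this]
    have h : (n : ℚ) + 1 ≠ 0 := by positivity
    simp only [Nat.add_sub_cancel]
    push_cast
    field_simp
    ring

theorem growth {f : ℝ → ℝ} {d : ℕ} {C : ℝ} (n1 : ℕ) (hC : 0 ≤ C)
    (h : ∀ n : ℕ, n1 ≤ n → |f n| ≤ C * (n : ℝ) ^ (d + 1))
    (C' : ℝ) (hC' : C * (2 ^ (d + 1) + 1) < C')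
    (h2 : ∀ n : ℕ, n1 ≤ n → C' * (n : ℝ) ^ d ≤ f (n + 1) - f n) : False := by
  set m := n1 + 1
  have hC'0 : 0 < C' := lt_of_le_of_lt (by positivity) hC'
  have key : ∀ k : ℕ, k * (C' * (m : ℝ) ^ d) ≤ f ((m + k : ℕ) : ℝ) - f m := by
    intro k
    induction k with
    | zero => simp
    | succ k ih =>
      have h3 := h2 (m + k) (by omega)
      have h4 : C' * (m : ℝ) ^ d ≤ C' * ((m + k : ℕ) : ℝ) ^ d := by
        gcongr
        omega
      push_cast at *
      rw [← add_assoc]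
      linarith
  have h5 := key m
  have h6 := h (m + m) (by omega)
  have h7 := h m (by omega)
  have hm : (0 : ℝ) < m := by positivity
  have h8 := abs_le.1 h6
  have h9 := abs_le.1 h7
  have h10 : (((m + m : ℕ) : ℝ)) ^ (d + 1) = 2 ^ (d + 1) * (m : ℝ) ^ (d + 1) := by
    push_cast
    rw [← two_mul, mul_pow]
  rw [h10] at h8
  have h11 : (m : ℝ) * (C' * (m : ℝ) ^ d) = C' * (m : ℝ) ^ (d + 1) := by ring
  rw [h11] at h5
  have h12 : 0 < (m : ℝ) ^ (d + 1) := by positivity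
  have h13 := mul_lt_mul_of_pos_right hC' h12
  nlinarith [h8.2, h9.1]

theorem intval (d : ℕ) : ∀ f ∈ H, (∀ᶠ n : ℕ in atTop, ∃ m : ℤ, f n = m) →
    (∃ C : ℕ, ∀ᶠ n : ℕ in atTop, |f n| ≤ C * (n : ℝ) ^ d) →
    ∃ q : ℚ[X], ∀ᶠ n : ℕ in atTop, f n = ((q.eval (n : ℚ) : ℚ) : ℝ) := by
  induction d with
  | zero =>
    rintro f hf hint ⟨C, hC⟩
    have hex : ∃ c ∈ Set.Icc (-(C : ℤ)) C, ∃ᶠ n : ℕ in atTop, f n = c := by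
      by_contra hcon
      push Not at hcon
      have : ∀ᶠ n : ℕ in atTop, ∀ c ∈ Set.Icc (-(C : ℤ)) C, f n ≠ c := by
        rw [Set.Finite.eventually_all (Set.finite_Icc _ _)]
        intro c hc
        simpa using hcon c hc
      obtain ⟨n, h1, ⟨m, hm⟩, h3⟩ := (this.and (hint.and hC)).exists
      refine h1 m ?_ hm
      rw [hm] at h3
      simp only [pow_zero, mul_one] at h3
      have h4 : |m| ≤ (C : ℤ) := by exact_mod_cast h3
      exact abs_le.1 h4
    obtain ⟨c, -, hc⟩ := hex
    refine ⟨Polynomial.C (c : ℚ), ?_⟩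
    have hmem : f - (fun _ => ((c : ℚ) : ℝ)) ∈ H := H.sub_mem hf (const_mem c)
    rcases dich' hmem with h | h
    · filter_upwards [natTop h] with n hn
      simp only [Pi.sub_apply] at hn
      simp only [eval_C]
      linarith
    · exfalso
      obtain ⟨n, h1, h2⟩ := (hc.and_eventually (natTop h)).exists
      apply h2
      simp [h1]
  | succ d ih =>
    rintro f hf hint ⟨C, hC⟩
    set g : ℝ → ℝ := (fun t => f (t + 1)) - f with hg
    have hgH : g ∈ H := H.sub_mem (shift_mem hf) hf
    have hgn : ∀ n : ℕ, g n = f ((n + 1 : ℕ) : ℝ) - f n := by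
      intro n; simp [hg]
    have hint' : ∀ᶠ n : ℕ in atTop, ∃ m : ℤ, f ((n + 1 : ℕ) : ℝ) = m :=
      (tendsto_add_atTop_nat 1).eventually hint
    have hgint : ∀ᶠ n : ℕ in atTop, ∃ m : ℤ, g n = m := by
      filter_upwards [hint, hint'] with n ⟨a, ha⟩ ⟨b, hb⟩
      exact ⟨b - a, by rw [hgn, ha, hb]; push_cast; rfl⟩
    have hbound : ∃ C' : ℕ, ∀ᶠ n : ℕ in atTop, |g n| ≤ C' * (n : ℝ) ^ d := by
      set C' : ℕ := C * (2 ^ (d + 1) + 1) + 1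
      have hC' : (C : ℝ) * (2 ^ (d + 1) + 1) < (C' : ℝ) := by
        simp only [C']; push_cast; linarith
      have hmono : (fun t : ℝ => ((C' : ℚ) : ℝ) * t ^ d) ∈ H :=
        H.mul_mem (const_mem C') (H.pow_mem id_mem d)
      have main : ∀ F ∈ H, (∀ᶠ n : ℕ in atTop, |F n| ≤ C * (n : ℝ) ^ (d + 1)) →
          ∀ᶠ n : ℕ in atTop, F (n + 1) - F n ≤ C' * (n : ℝ) ^ d := by
        intro F hF hFC
        have hmem : ((fun t => F (t + 1)) - F) - (fun t : ℝ => ((C' : ℚ) : ℝ) * t ^ d) ∈ H :=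
          H.sub_mem (H.sub_mem (shift_mem hF) hF) hmono
        have : (∀ᶠ t in atTop, (((fun t => F (t + 1)) - F) - (fun t : ℝ => ((C' : ℚ) : ℝ) * t ^ d)) t ≤ 0)
           ∨ (∀ᶠ t in atTop, 0 ≤ (((fun t => F (t + 1)) - F) - (fun t : ℝ => ((C' : ℚ) : ℝ) * t ^ d)) t) := by
          rcases dich hmem with h | h | h
          · exact Or.inl (h.mono fun _ h => h.le)
          · exact Or.inr (h.mono fun _ h => h.le)
          · exact Or.inl (h.mono fun _ h => h.le)
        rcases this with h | h
        · filter_upwards [natTop h] with n hn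
          simp only [Pi.sub_apply, Rat.cast_natCast] at hn
          linarith
        · exfalso
          obtain ⟨n1, hn1⟩ := ((natTop h).and hFC).exists_forall_of_atTop
          refine growth (f := F) n1 (Nat.cast_nonneg C) (fun n hn => (hn1 n hn).2) C' hC' ?_
          intro n hn
          have := (hn1 n hn).1
          simp only [Pi.sub_apply, Rat.cast_natCast] at this
          linarith
      refine ⟨C', ?_⟩
      have h1 := main f hf hC
      have h2 := main (-f) (H.neg_mem hf) (by simpa using hC)
      filter_upwards [h1, h2] with n a b
      rw [hgn, abs_le]
      simp only [Pi.neg_apply] at b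
      push_cast at *
      constructor <;> linarith
    obtain ⟨q, hq⟩ := ih g hgH hgint hbound
    obtain ⟨Q, hQ⟩ := antidiff q
    obtain ⟨n1, hn1⟩ := (hq.and hint).exists_forall_of_atTop
    obtain ⟨m, hm⟩ := (hn1 n1 le_rfl).2
    refine ⟨Q + Polynomial.C ((m : ℚ) - Q.eval (n1 : ℚ)), ?_⟩
    filter_upwards [eventually_ge_atTop n1] with n hn
    induction n, hn using Nat.le_induction with
    | base => simp [hm]
    | succ n hn ih2 =>
      have h3 := (hn1 n hn).1
      rw [hgn] at h3
      have h4 := hQ n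
      have h5 : f ((n + 1 : ℕ) : ℝ) = f n + ((q.eval (n : ℚ) : ℚ) : ℝ) := by linarith
      rw [h5, ih2, ← h4]
      simp only [eval_add, eval_C]
      push_cast
      ring

section cont
attribute [local instance] Matrix.linftyOpNormedRing Matrix.linftyOpNormedAlgebra

theorem eig_cont {T : Type*} [TopologicalSpace T] {K : Type*} [Fintype K] [DecidableEq K]
    (S : T → Matrix K K ℝ) (hS : ∀ t, (S t).IsHermitian) (hc0 : ∀ i j, Continuous fun t => S t i j) :
    Continuous fun t => (hS t).eigenvalues₀ := by
  have hc : Continuous S := continuous_matrix hc0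
  rw [continuous_iff_continuousAt]
  intro t0
  unfold ContinuousAt
  rw [tendsto_iff_ultrafilter]
  intro U hU
  have hbd : ∀ t i, ‖(hS t).eigenvalues₀ i‖ ≤ ‖S t‖ * ‖(1 : Matrix K K ℝ)‖ := by
    intro t i
    have := (hS t).eigenvalues_mem_spectrum_real ((Fintype.equivOfCardEq (Fintype.card_fin _)) i)
    have h2 := spectrum.norm_le_norm_mul_of_mem this
    simpa [Matrix.IsHermitian.eigenvalues] using h2
  have hK : IsCompact (Set.pi Set.univ fun _ : Fin (Fintype.card K) =>
      Metric.closedBall (0 : ℝ) ((‖S t0‖ + 1) * ‖(1 : Matrix K K ℝ)‖)) :=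
    isCompact_univ_pi fun _ => isCompact_closedBall _ _
  have hn : Continuous fun t => ‖S t‖ := hc.norm
  have hev : ∀ᶠ t in 𝓝 t0, (hS t).eigenvalues₀ ∈ (Set.pi Set.univ fun _ : Fin (Fintype.card K) =>
      Metric.closedBall (0 : ℝ) ((‖S t0‖ + 1) * ‖(1 : Matrix K K ℝ)‖)) := by
    have : ∀ᶠ t in 𝓝 t0, ‖S t‖ < ‖S t0‖ + 1 :=
      hn.continuousAt.eventually_lt_const (lt_add_one _)
    filter_upwards [this] with t ht i _
    rw [mem_closedBall_zero_iff]
    exact (hbd t i).trans (by gcongr)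
  obtain ⟨v, hvK, hv⟩ := hK.ultrafilter_le_nhds' (U.map fun t => (hS t).eigenvalues₀) (hU hev)
  have hv' : Tendsto (fun t => (hS t).eigenvalues₀) U (𝓝 v) := hv
  suffices h : v = (hS t0).eigenvalues₀ by
    rw [h] at hv'
    exact hv'
  have hvi : ∀ i, Tendsto (fun t => (hS t).eigenvalues₀ i) U (𝓝 (v i)) := tendsto_pi_nhds.1 hv'
  have hanti : Antitone v := by
    intro i j hij
    exact le_of_tendsto_of_tendsto' (hvi j) (hvi i) fun t => (hS t).eigenvalues₀_antitone hij
  have hcp : ∀ t, (S t).charpoly = ∏ i, (X - Polynomial.C ((hS t).eigenvalues₀ i)) := by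
    intro t
    rw [(hS t).charpoly_eq]
    exact Fintype.prod_equiv (Fintype.equivOfCardEq (Fintype.card_fin _)).symm _ _ (fun i => rfl)
  have hpoly : ∏ i, (X - Polynomial.C (v i)) = ∏ i, (X - Polynomial.C ((hS t0).eigenvalues₀ i)) := by
    refine Polynomial.funext fun z => ?_
    have h1 : Tendsto (fun t => (S t).charpoly.eval z) U (𝓝 ((∏ i, (X - Polynomial.C (v i))).eval z)) := by
      simp only [hcp, eval_prod, eval_sub, eval_X, eval_C]
      exact tendsto_finsetProd _ fun i _ => tendsto_const_nhds.sub (hvi i)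
    have h2 : Tendsto (fun t => (S t).charpoly.eval z) U (𝓝 ((S t0).charpoly.eval z)) := by
      simp only [Matrix.eval_charpoly]
      have : Continuous fun t => (Matrix.scalar K z - S t).det := 
        (continuous_const.sub hc).matrix_det
      exact (this.tendsto t0).mono_left hU
    rw [← hcp]
    exact tendsto_nhds_unique h1 h2
  have hrt : ∀ u : Fin (Fintype.card K) → ℝ, (∏ i, (X - Polynomial.C (u i))).roots = (List.ofFn u : Multiset ℝ) := by
    intro u
    rw [← Polynomial.roots_multiset_prod_X_sub_C (List.ofFn u : Multiset ℝ)]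
    congr 1
    rw [Multiset.map_coe, Multiset.prod_coe, List.map_ofFn, List.prod_ofFn]
    rfl
  have hr := congrArg Polynomial.roots hpoly
  rw [hrt, hrt, Multiset.coe_eq_coe] at hr
  have h1 := hanti.sortedGE_ofFn
  have h2 := (hS t0).eigenvalues₀_antitone.sortedGE_ofFn
  exact List.ofFn_injective (hr.eq_of_sortedGE h1 h2)
end cont

end S15


namespace S15
open Polynomial Filter Topology

theorem perm_ext {A : Type*} {n : ℕ} (u u' : A → Fin n) (h : ∀ a b, u a = u b ↔ u' a = u' b) :
    ∃ σ : Equiv.Perm (Fin n), ∀ a, σ (u a) = u' a := by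
  classical
  let e : {x // x ∈ Set.range u} ≃ {x // x ∈ Set.range u'} :=
    Equiv.ofBijective (fun x => ⟨u' x.2.choose, ⟨_, rfl⟩⟩) (by
      constructor
      · intro x y hxy
        have h1 : u' x.2.choose = u' y.2.choose := congrArg Subtype.val hxy
        rw [← h, x.2.choose_spec, y.2.choose_spec] at h1
        exact Subtype.ext h1
      · rintro ⟨_, a, rfl⟩
        refine ⟨⟨u a, a, rfl⟩, Subtype.ext ?_⟩
        have hx : u a ∈ Set.range u := ⟨a, rfl⟩
        exact (h _ _).1 hx.choose_spec)
  refine ⟨e.extendSubtype, fun a => ?_⟩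
  have hx : u a ∈ Set.range u := ⟨a, rfl⟩
  rw [e.extendSubtype_apply_of_mem _ hx]
  exact (h _ _).1 hx.choose_spec

theorem emb_trans {m n : ℕ} (f g : Fin m ↪ Fin n) : ∃ σ : Equiv.Perm (Fin n), f.trans σ.toEmbedding = g := by
  obtain ⟨σ, hσ⟩ := perm_ext f g (fun a b => by simp)
  exact ⟨σ, by ext a; simp [hσ]⟩

/-- factor an injection through a middle set -/
theorem emb_factor {m p n : ℕ} (hmp : m ≤ p) (hpn : p ≤ n) (f : Fin m ↪ Fin n) :
    ∃ g : Fin p ↪ Fin n, (Fin.castLEEmb hmp).trans g = f := by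
  obtain ⟨σ, hσ⟩ := emb_trans (Fin.castLEEmb (hmp.trans hpn)) f
  refine ⟨(Fin.castLEEmb hpn).trans σ.toEmbedding, ?_⟩
  rw [← hσ]
  ext a; simp

def Gen (Y : FISet) (N k : ℕ) (w : Fin k → Y.obj N) : Prop :=
  ∀ n, N ≤ n → ∀ y : Y.obj n, ∃ κ, ∃ f : Fin N ↪ Fin n, Y.map f (w κ) = y

theorem gen_exists (Y : FISet) (hY : Y.FG) : ∃ k N, ∃ w : Fin k → Y.obj N, Gen Y N k w := by
  obtain ⟨d, hd⟩ := hY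
  let e := (Fintype.equivFin (Y.obj d)).symm
  refine ⟨Fintype.card (Y.obj d), d, e, ?_⟩
  intro n hn y
  obtain ⟨m, hm, f, z, rfl⟩ := hd n y
  obtain ⟨g, hg⟩ := emb_factor hm hn f
  refine ⟨e.symm (Y.map (Fin.castLEEmb hm) z), g, ?_⟩
  rw [e.apply_symm_apply, ← Y.map_comp, hg]

theorem same_orbit (Y : FISet) {m n : ℕ} (f g : Fin m ↪ Fin n) (w : Y.obj m) :
    ∃ σ : Equiv.Perm (Fin n), Y.map σ.toEmbedding (Y.map f w) = Y.map g w := by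
  obtain ⟨σ, hσ⟩ := emb_trans f g
  exact ⟨σ, by rw [← Y.map_comp, hσ]⟩

theorem basis (Y : FISet) (hY : Y.FG) : ∃ k N, ∃ w : Fin k → Y.obj N, Gen Y N k w ∧
    ∀ n (f g : Fin N ↪ Fin n) κ κ', Y.map f (w κ) = Y.map g (w κ') → κ = κ' := by
  classical
  have hex := gen_exists Y hY
  obtain ⟨k, ⟨N, w, hw⟩, hmin⟩ : ∃ k, (∃ N, ∃ w : Fin k → Y.obj N, Gen Y N k w) ∧
      ∀ m, m < k → ¬ (∃ N, ∃ w : Fin m → Y.obj N, Gen Y N m w) :=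
    ⟨Nat.find hex, Nat.find_spec hex, fun m hm => Nat.find_min hex hm⟩
  refine ⟨k, N, w, hw, ?_⟩
  intro n f g κ κ' h
  by_contra hne
  have hNn : N ≤ n := by simpa using Fintype.card_le_of_embedding f
  obtain ⟨k', hk'⟩ : ∃ k', k = k' + 1 := ⟨k - 1, by have := κ.2; omega⟩
  apply hmin k' (by omega)
  -- remove κ
  have hcard : Fintype.card {x : Fin k // x ≠ κ} = k' := by
    simp [Fintype.card_subtype_compl, hk']
  let e := (Fintype.equivFinOfCardEq hcard).symm
  let c := Fin.castLEEmb hNn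
  refine ⟨n, fun i => Y.map c (w (e i)), ?_⟩
  intro n' hn' y
  obtain ⟨μ, p, hp⟩ := hw n' (hNn.trans hn') y
  obtain ⟨p', hp'⟩ := emb_factor hNn hn' p
  -- replacement
  have hrep : ∃ i, ∃ σ : Equiv.Perm (Fin n), Y.map σ.toEmbedding (Y.map c (w (e i))) = Y.map c (w μ) := by
    by_cases hμ : μ = κ
    · subst hμ
      obtain ⟨σ, hσ⟩ := same_orbit Y f c (w μ)
      obtain ⟨τ, hτ⟩ := same_orbit Y c g (w κ')
      refine ⟨e.symm ⟨κ', fun h => hne h.symm⟩, τ.trans σ, ?_⟩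
      rw [e.apply_symm_apply]
      have : (τ.trans σ).toEmbedding = τ.toEmbedding.trans σ.toEmbedding := by ext; rfl
      rw [this, Y.map_comp, hτ, ← h, hσ]
    · refine ⟨e.symm ⟨μ, hμ⟩, Equiv.refl _, ?_⟩
      rw [e.apply_symm_apply]
      exact Y.map_id _ _
  obtain ⟨i, σ, hi⟩ := hrep
  refine ⟨i, σ.toEmbedding.trans p', ?_⟩
  rw [Y.map_comp, hi, ← Y.map_comp, hp', hp]

/-- sequences given eventually by elements of H -/
def EvH (a : ℕ → ℝ) : Prop := ∃ f ∈ H, ∀ᶠ n : ℕ in atTop, a n = f n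

theorem EvH.congr {a b : ℕ → ℝ} (ha : EvH a) (h : ∀ᶠ n in atTop, a n = b n) : EvH b := by
  obtain ⟨f, hf, hfa⟩ := ha
  exact ⟨f, hf, by filter_upwards [h, hfa] with n h1 h2; rw [← h1, h2]⟩

theorem EvH.sum {ι : Type*} (s : Finset ι) (a : ι → ℕ → ℝ) (h : ∀ i ∈ s, EvH (a i)) :
    EvH (fun n => ∑ i ∈ s, a i n) := by
  classical
  induction s using Finset.induction_on with
  | empty => exact ⟨0, H.zero_mem, by simp⟩
  | insert i s hi ih =>
    obtain ⟨f, hf, hfa⟩ := ih (fun i hi => h i (Finset.mem_insert_of_mem hi))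
    obtain ⟨g, hg, hga⟩ := h i (Finset.mem_insert_self _ _)
    refine ⟨g + f, H.add_mem hg hf, ?_⟩
    filter_upwards [hfa, hga] with n h1 h2
    rw [Finset.sum_insert hi, h1, h2]; rfl

theorem EvH.mul {a b : ℕ → ℝ} (ha : EvH a) (hb : EvH b) : EvH (fun n => a n * b n) := by
  obtain ⟨f, hf, hfa⟩ := ha
  obtain ⟨g, hg, hga⟩ := hb
  exact ⟨f * g, H.mul_mem hf hg, by filter_upwards [hfa, hga] with n h1 h2; simp [h1, h2]⟩

theorem H_ne_of_nat {f : ℝ → ℝ} (hf : f ∈ H) (h : ∀ᶠ n : ℕ in atTop, f n ≠ 0) :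
    ∀ᶠ t in atTop, f t ≠ 0 := by
  rcases dich' hf with h1 | h1
  · obtain ⟨n, h2, h3⟩ := (h.and (natTop h1)).exists
    exact absurd h3 h2
  · exact h1

theorem EvH.div {a b : ℕ → ℝ} (ha : EvH a) (hb : EvH b) (h : ∀ᶠ n in atTop, b n ≠ 0) :
    EvH (fun n => a n / b n) := by
  obtain ⟨f, hf, hfa⟩ := ha
  obtain ⟨g, hg, hga⟩ := hb
  refine ⟨f / g, div_mem hf hg (H_ne_of_nat hg ?_), ?_⟩
  · filter_upwards [h, hga] with n h1 h2; rwa [← h2]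
  · filter_upwards [hfa, hga] with n h1 h2; simp [h1, h2]

theorem EvH.descFactorial (k : ℕ) : EvH (fun n => (n.descFactorial k : ℝ)) := by
  refine ⟨phi (descPochhammer ℚ k), phi_mem _, Eventually.of_forall fun n => ?_⟩
  rw [phi_apply]
  have := descPochhammer_eval_eq_descFactorial ℚ n k
  have h2 := Polynomial.aeval_algebraMap_apply (A := ℚ) ℝ (n : ℚ) (descPochhammer ℚ k)
  simp only [eq_ratCast, Rat.cast_natCast] at h2
  rw [h2, Polynomial.coe_aeval_eq_eval, this]
  simp

theorem ev_const {α : Type*} [Finite α] (S : ℕ → Set α) (N : ℕ) (h : ∀ m n, N ≤ m → m ≤ n → S m ⊆ S n) :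
    ∃ T : Set α, ∀ᶠ n in atTop, S n = T := by
  let F : ℕ →o Set α := ⟨fun n => S (N + n), fun a b hab => h _ _ (by omega) (by omega)⟩
  obtain ⟨n0, hn0⟩ := WellFoundedGT.monotone_chain_condition F
  refine ⟨S (N + n0), ?_⟩
  filter_upwards [eventually_ge_atTop (N + n0)] with n hn
  have := hn0 (n - N) (by omega)
  have h2 : S (N + n0) = S (N + (n - N)) := this
  rw [h2]
  congr 1
  omega

end S15


namespace S15
open Polynomial Filter Topology

theorem card_ker {A : Type} [Finite A] (s : Setoid A) (n : ℕ) :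
    Nat.card {u : A → Fin n // Setoid.ker u = s} = n.descFactorial (Nat.card (Quotient s)) := by
  classical
  have := Fintype.ofFinite (Quotient s)
  let e : {u : A → Fin n // Setoid.ker u = s} ≃ (Quotient s ↪ Fin n) :=
    { toFun := fun u => ⟨Quotient.lift u.1 (fun a b hab => by
          have h : (Setoid.ker u.1) a b := by rw [u.2]; exact hab
          exact h), by
          intro x y
          induction x using Quotient.inductionOn
          induction y using Quotient.inductionOn
          rename_i a b
          intro h
          apply Quotient.sound
          have h : (Setoid.ker u.1) a b := h
          rw [u.2] at h; exact h⟩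
      invFun := fun e => ⟨fun a => e (Quotient.mk s a), by
        ext a b
        rw [Setoid.ker_def, e.injective.eq_iff]
        exact Quotient.eq⟩
      left_inv := fun u => by ext; rfl
      right_inv := fun e => by
        ext x
        induction x using Quotient.inductionOn
        rfl }
  rw [Nat.card_congr e, Nat.card_eq_fintype_card, Fintype.card_embedding_eq]
  simp

instance {A : Type} [Finite A] : Finite (Setoid A) :=
  Finite.of_injective (fun s : Setoid A => (fun a b => s a b : A → A → Prop)) (by
    intro s t h
    ext a b
    exact iff_of_eq (congrFun (congrFun h a) b))

theorem card_ker_mem {A : Type} [Finite A] (T : Set (Setoid A)) (n : ℕ) :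
    (Nat.card {u : A → Fin n // Setoid.ker u ∈ T} : ℝ) =
      ∑ s ∈ T.toFinite.toFinset, (n.descFactorial (Nat.card (Quotient s)) : ℝ) := by
  classical
  have := Fintype.ofFinite A
  have h := Finset.card_eq_sum_card_fiberwise (s := Finset.univ.filter fun u : A → Fin n => Setoid.ker u ∈ T)
    (t := T.toFinite.toFinset) (f := fun u => Setoid.ker u) (by intro u hu; simpa using hu)
  rw [Nat.card_eq_fintype_card, Fintype.card_subtype, h]
  push_cast
  refine Finset.sum_congr rfl fun s hs => ?_
  rw [← card_ker, Nat.card_eq_fintype_card, Fintype.card_subtype, Finset.filter_filter]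
  congr 2
  ext u
  simp only [Finset.mem_filter, Finset.mem_univ, true_and]
  refine ⟨fun h => h.2, fun h => ⟨?_, h⟩⟩
  rw [h]; simpa using hs

theorem pair_count (Y : FISet) {N : ℕ} (w : Y.obj N) :
    EvH (fun n => (Nat.card {p : (Fin N ↪ Fin n) × (Fin N ↪ Fin n) // Y.map p.1 w = Y.map p.2 w} : ℝ)) := by
  classical
  let T : ℕ → Set (Setoid (Fin N ⊕ Fin N)) := fun n => {s | ∃ p : (Fin N ↪ Fin n) × (Fin N ↪ Fin n),
    Setoid.ker (Sum.elim p.1 p.2) = s ∧ Y.map p.1 w = Y.map p.2 w}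
  obtain ⟨T', hT'⟩ := ev_const T 0 (by
    rintro m n - hmn s ⟨p, hp, hw⟩
    let c := Fin.castLEEmb hmn
    refine ⟨(p.1.trans c, p.2.trans c), ?_, ?_⟩
    · rw [← hp]
      ext a b
      rw [Setoid.ker_def, Setoid.ker_def]
      have : ∀ a, Sum.elim (p.1.trans c) (p.2.trans c) a = c (Sum.elim p.1 p.2 a) := by
        rintro (a | a) <;> rfl
      rw [this, this, c.injective.eq_iff]
    · simp only [Y.map_comp, hw])
  have hmain : ∀ n, Nat.card {p : (Fin N ↪ Fin n) × (Fin N ↪ Fin n) // Y.map p.1 w = Y.map p.2 w}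
      = Nat.card {u : Fin N ⊕ Fin N → Fin n // Setoid.ker u ∈ T n} := by
    intro n
    refine Nat.card_congr (Equiv.ofBijective
      (fun p => ⟨Sum.elim p.1.1 p.1.2, p.1, rfl, p.2⟩) ⟨?_, ?_⟩)
    · rintro ⟨⟨f, g⟩, h⟩ ⟨⟨f', g'⟩, h'⟩ heq
      have h1 : Sum.elim (f : Fin N → Fin n) g = Sum.elim f' g' := congrArg Subtype.val heq
      have h2 : f = f' := by ext a; exact congrArg Fin.val (congrFun h1 (Sum.inl a))
      have h3 : g = g' := by ext a; exact congrArg Fin.val (congrFun h1 (Sum.inr a))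
      subst h2 h3; rfl
    · rintro ⟨u, ⟨p, hp, hw⟩⟩
      have hk : ∀ a b, Sum.elim p.1 p.2 a = Sum.elim p.1 p.2 b ↔ u a = u b := by
        intro a b
        rw [← Setoid.ker_def (f := u), ← hp, Setoid.ker_def]
      obtain ⟨σ, hσ⟩ := perm_ext (Sum.elim p.1 p.2) u hk
      refine ⟨⟨(p.1.trans σ.toEmbedding, p.2.trans σ.toEmbedding), ?_⟩, ?_⟩
      · simp only [Y.map_comp, hw]
      · apply Subtype.ext
        funext a
        refine Eq.trans ?_ (hσ a)
        rcases a with a | a <;> rfl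
  refine EvH.congr (EvH.sum T'.toFinite.toFinset (fun s n => (n.descFactorial (Nat.card (Quotient s)) : ℝ))
    fun s _ => EvH.descFactorial _) ?_
  filter_upwards [hT'] with n hn
  rw [hmain, hn, card_ker_mem]

/-- the FI-subset generated by w -/
def orb (Y : FISet) {N : ℕ} (w : Y.obj N) (n : ℕ) : Set (Y.obj n) := {y | ∃ f : Fin N ↪ Fin n, Y.map f w = y}

theorem orb_sub (Y : FISet) {N : ℕ} (w : Y.obj N) : Y.IsFISubset (orb Y w) := by
  rintro m n g _ ⟨f, rfl⟩
  exact ⟨f.trans g, Y.map_comp _ _ _⟩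

theorem orb_count (Y : FISet) {N : ℕ} (w : Y.obj N) :
    EvH (fun n => (Nat.card (orb Y w n) : ℝ)) := by
  classical
  have hkey : ∀ n, N ≤ n → (Nat.card (orb Y w n) : ℝ) = ((n.descFactorial N : ℝ) * n.descFactorial N) /
      (Nat.card {p : (Fin N ↪ Fin n) × (Fin N ↪ Fin n) // Y.map p.1 w = Y.map p.2 w} : ℝ) ∧
      (Nat.card {p : (Fin N ↪ Fin n) × (Fin N ↪ Fin n) // Y.map p.1 w = Y.map p.2 w} : ℝ) ≠ 0 := by
    intro n hn
    let f0 : Fin N ↪ Fin n := Fin.castLEEmb hn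
    -- fibre size
    set c := Nat.card {g : Fin N ↪ Fin n // Y.map g w = Y.map f0 w} with hc
    have hcy : ∀ f : Fin N ↪ Fin n, Nat.card {g : Fin N ↪ Fin n // Y.map g w = Y.map f w} = c := by
      intro f
      obtain ⟨σ, hσ⟩ := emb_trans f f0
      have hinj : ∀ x y : Y.obj n, Y.map σ.toEmbedding x = Y.map σ.toEmbedding y ↔ x = y := by
        intro x y
        exact (MulAction.injective σ).eq_iff
      refine Nat.card_congr (Equiv.subtypeEquiv
        (⟨fun g => g.trans σ.toEmbedding, fun g => g.trans σ.symm.toEmbedding, ?_, ?_⟩ :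
          (Fin N ↪ Fin n) ≃ (Fin N ↪ Fin n)) ?_)
      · intro g; ext a; simp
      · intro g; ext a; simp
      · intro g
        simp only [Equiv.coe_fn_mk]
        rw [← hσ, Y.map_comp, Y.map_comp, hinj]
    have hc0 : 0 < c := by
      rw [hc]
      exact Nat.card_pos_iff.2 ⟨⟨⟨f0, rfl⟩⟩, inferInstance⟩
    have hD : Nat.card (Fin N ↪ Fin n) = n.descFactorial N := by
      rw [Nat.card_eq_fintype_card, Fintype.card_embedding_eq]; simp
    have h1 : Nat.card (orb Y w n) * c = n.descFactorial N := by
      rw [← hD]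
      have e : (Fin N ↪ Fin n) ≃ Σ y : orb Y w n, {g : Fin N ↪ Fin n // Y.map g w = y.1} :=
        ⟨fun g => ⟨⟨Y.map g w, g, rfl⟩, g, rfl⟩, fun x => x.2.1, fun g => rfl, by
          rintro ⟨⟨y, hy⟩, g, hg⟩
          simp only at hg
          subst hg
          rfl⟩
      rw [Nat.card_congr e, Nat.card_sigma]
      rw [Finset.sum_congr rfl (g := fun _ => c)]
      · simp [Nat.card_eq_fintype_card]
      · rintro ⟨y, f, rfl⟩ _
        exact hcy f
    have h2 : Nat.card {p : (Fin N ↪ Fin n) × (Fin N ↪ Fin n) // Y.map p.1 w = Y.map p.2 w}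
       = n.descFactorial N * c := by
      rw [← hD]
      have e : {p : (Fin N ↪ Fin n) × (Fin N ↪ Fin n) // Y.map p.1 w = Y.map p.2 w} ≃
          Σ f : Fin N ↪ Fin n, {g : Fin N ↪ Fin n // Y.map g w = Y.map f w} :=
        ⟨fun p => ⟨p.1.2, p.1.1, p.2⟩, fun x => ⟨(x.2.1, x.1), x.2.2⟩, fun _ => rfl, fun _ => rfl⟩
      rw [Nat.card_congr e, Nat.card_sigma]
      rw [Finset.sum_congr rfl (g := fun _ => c) (fun f _ => hcy f)]
      simp [Nat.card_eq_fintype_card]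
    have hd0 : 0 < n.descFactorial N := Nat.descFactorial_pos.2 hn
    rw [h2, ← h1] 
    have ho : Nat.card (orb Y w n) ≠ 0 := by
      intro h; rw [h] at h1; omega
    have ho' : (Nat.card (orb Y w n) : ℝ) ≠ 0 := by exact_mod_cast ho
    have hc' : (c : ℝ) ≠ 0 := by exact_mod_cast hc0.ne'
    constructor
    · push_cast
      field_simp
    · push_cast
      positivity
  refine EvH.congr (EvH.div ((EvH.descFactorial N).mul (EvH.descFactorial N)) (pair_count Y w) ?_) ?_
  · filter_upwards [eventually_ge_atTop N] with n hn using (hkey n hn).2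
  · filter_upwards [eventually_ge_atTop N] with n hn using (hkey n hn).1.symm

theorem sub_perm (Y : FISet) (R : ∀ n, Set (Y.obj n)) (hR : Y.IsFISubset R) {m n : ℕ} (f g : Fin m ↪ Fin n)
    (w : Y.obj m) (h : Y.map f w ∈ R n) : Y.map g w ∈ R n := by
  obtain ⟨σ, hσ⟩ := same_orbit Y f g w
  rw [← hσ]
  exact hR _ _ h

/-- An FI-subset is eventually a fixed union of basis orbits. -/
theorem sub_stable (Y : FISet) {k N : ℕ} (w : Fin k → Y.obj N)
    (R : ∀ n, Set (Y.obj n)) (hR : Y.IsFISubset R) :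
    ∃ T : Set (Fin k), ∀ᶠ n in atTop, ∀ κ (f : Fin N ↪ Fin n), Y.map f (w κ) ∈ R n ↔ κ ∈ T := by
  obtain ⟨T, hT⟩ := ev_const (fun n => {κ : Fin k | ∃ f : Fin N ↪ Fin n, Y.map f (w κ) ∈ R n}) 0 (by
    rintro m n - hmn κ ⟨f, hf⟩
    refine ⟨f.trans (Fin.castLEEmb hmn), ?_⟩
    rw [Y.map_comp]
    exact hR _ _ hf)
  refine ⟨T, ?_⟩
  filter_upwards [hT] with n hn κ f
  rw [← hn]
  exact ⟨fun h => ⟨f, h⟩, fun ⟨g, h⟩ => sub_perm Y R hR g f _ h⟩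

theorem sub_count (Y : FISet) (hY : Y.FG) (R : ∀ n, Set (Y.obj n)) (hR : Y.IsFISubset R) :
    EvH (fun n => (Nat.card (R n) : ℝ)) := by
  classical
  obtain ⟨k, N, w, hgen, hu⟩ := basis Y hY
  obtain ⟨T, hT⟩ := sub_stable Y w R hR
  refine EvH.congr (EvH.sum T.toFinite.toFinset (fun κ n => (Nat.card (orb Y (w κ) n) : ℝ))
    fun κ _ => orb_count Y (w κ)) ?_
  filter_upwards [hT, eventually_ge_atTop N] with n hn hNn
  have e : (Σ κ : T, orb Y (w κ) n) ≃ R n := by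
    refine Equiv.ofBijective (fun x => ⟨x.2.1, ?_⟩) ⟨?_, ?_⟩
    · obtain ⟨⟨κ, hκ⟩, ⟨_, f, rfl⟩⟩ := x
      exact (hn κ f).2 hκ
    · rintro ⟨⟨κ, hκ⟩, ⟨_, f, rfl⟩⟩ ⟨⟨κ', hκ'⟩, ⟨_, f', rfl⟩⟩ h
      have h1 : Y.map f (w κ) = Y.map f' (w κ') := congrArg Subtype.val h
      obtain rfl := hu n f f' κ κ' h1
      simp only [h1]
    · rintro ⟨y, hy⟩
      obtain ⟨κ, f, rfl⟩ := hgen n hNn y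
      exact ⟨⟨⟨κ, (hn κ f).1 hy⟩, ⟨_, f, rfl⟩⟩, rfl⟩
  rw [← Nat.card_congr e, Nat.card_sigma]
  push_cast
  refine Finset.sum_bij' (fun κ h => (⟨κ, by simpa using h⟩ : T)) (fun κ _ => κ.1) ?_ ?_ ?_ ?_ ?_ <;> simp

theorem prod_FG (X Y : FISet) (hX : X.FG) (hY : Y.FG) : (X.prod Y).FG := by
  classical
  obtain ⟨d, hd⟩ := hX
  obtain ⟨d', hd'⟩ := hY
  refine ⟨d + d', ?_⟩
  rintro n ⟨x, y⟩
  obtain ⟨m, hm, f, a, rfl⟩ := hd n x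
  obtain ⟨m', hm', g, b, rfl⟩ := hd' n y
  let s : Finset (Fin n) := Finset.univ.map f ∪ Finset.univ.map g
  have hs : s.card ≤ d + d' := (Finset.card_union_le _ _).trans (by simp; omega)
  let h : Fin s.card ↪ Fin n := (s.orderEmbOfFin rfl).toEmbedding
  have hr : ∀ x ∈ s, ∃ i, h i = x := by
    intro x hx
    have := Finset.range_orderEmbOfFin s rfl
    have hx' : x ∈ Set.range (s.orderEmbOfFin rfl) := by rw [this]; exact hx
    exact hx'
  have hfac : ∀ {m : ℕ} (f : Fin m ↪ Fin n), (∀ i, f i ∈ s) → ∃ f' : Fin m ↪ Fin s.card, f'.trans h = f := by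
    intro m f hf
    choose F hF using fun i => hr (f i) (hf i)
    refine ⟨⟨F, ?_⟩, ?_⟩
    · intro i j hij
      apply f.injective
      rw [← hF, ← hF, hij]
    · ext i
      exact congrArg Fin.val (hF i)
  obtain ⟨f', hf'⟩ := hfac f (by intro i; simp [s])
  obtain ⟨g', hg'⟩ := hfac g (by intro i; simp [s])
  refine ⟨s.card, hs, h, (X.map f' a, Y.map g' b), ?_⟩
  change (X.map h (X.map f' a), Y.map h (Y.map g' b)) = _
  rw [← X.map_comp, ← Y.map_comp, hf', hg']

theorem card_bound (X : FISet) (hX : X.FG) : ∃ C d : ℕ, ∀ᶠ n : ℕ in atTop,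
    Fintype.card (X.obj n) ≤ C * n ^ d := by
  obtain ⟨k, N, w, hw⟩ := gen_exists X hX
  refine ⟨k, N, ?_⟩
  filter_upwards [eventually_ge_atTop N] with n hn
  have hs : Function.Surjective (fun p : Fin k × (Fin N ↪ Fin n) => X.map p.2 (w p.1)) := by
    intro y
    obtain ⟨κ, f, h⟩ := hw n hn y
    exact ⟨(κ, f), h⟩
  refine (Fintype.card_le_of_surjective _ hs).trans ?_
  rw [Fintype.card_prod, Fintype.card_embedding_eq]
  simp only [Fintype.card_fin]
  gcongr
  exact Nat.descFactorial_le_pow _ _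

end S15

namespace S15
open Polynomial Filter Topology
set_option linter.unusedSectionVars false

section core
variable {V K : Type*} [Fintype V] [DecidableEq V] [Fintype K] [DecidableEq K]

theorem trace_aeval (R : Matrix V V ℝ) (hR : R.IsHermitian) (p : ℝ[X]) :
    (aeval R p).trace = ∑ v, p.eval (hR.eigenvalues v) := by
  set U : Matrix V V ℝ := (hR.eigenvectorUnitary : Matrix V V ℝ) with hU
  have h1 : star U * U = 1 := by simp [hU]
  have hs : R = U * Matrix.diagonal hR.eigenvalues * star U := by
    have := hR.spectral_theorem
    rw [Unitary.conjStarAlgAut_apply] at this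
    simpa [hU] using this
  have h2 : ∀ p : ℝ[X], aeval R p * U = U * Matrix.diagonal (fun v => p.eval (hR.eigenvalues v)) := by
    intro p
    induction p using Polynomial.induction_on' with
    | add p q hp hq =>
      rw [map_add, add_mul, hp, hq, ← mul_add, Matrix.diagonal_add]
      simp
    | monomial n a =>
      have hRU : R * U = U * Matrix.diagonal hR.eigenvalues := by
        conv_lhs => rw [hs]
        rw [mul_assoc, h1, mul_one]
      have : ∀ n, R ^ n * U = U * Matrix.diagonal (hR.eigenvalues ^ n) := by
        intro n
        rw [← Matrix.diagonal_pow]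
        induction n with
        | zero => simp
        | succ n ih => rw [pow_succ, mul_assoc, hRU, ← mul_assoc, ih, mul_assoc, ← pow_succ]
      rw [aeval_monomial, mul_assoc, this, Algebra.algebraMap_eq_smul_one, smul_mul_assoc, one_mul,
        ← mul_smul_comm]
      congr 1
      rw [← Matrix.diagonal_smul]
      congr 1
      funext v
      simp
  have h3 : U * star U = 1 := by simp [hU]
  have : aeval R p = (U * Matrix.diagonal (fun v => p.eval (hR.eigenvalues v))) * star U := by
    rw [← h2, mul_assoc, h3, mul_one]
  rw [this, Matrix.trace_mul_comm, ← mul_assoc, h1, one_mul, Matrix.trace_diagonal]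

theorem mult_eq (R : Matrix V V ℝ) (hR : R.IsHermitian) (μ : ℝ) :
    Module.finrank ℝ (Module.End.maxGenEigenspace (Matrix.toLin' R) μ) =
      (Finset.univ.filter fun v => hR.eigenvalues v = μ).card := by
  rw [LinearMap.finrank_maxGenEigenspace_eq, Matrix.charpoly_toLin', ← Polynomial.count_roots,
    hR.roots_charpoly_eq_eigenvalues, Multiset.count_map]
  simp only [Finset.card, Finset.filter_val]
  congr 1
  apply Multiset.filter_congr
  intro v _
  simp [eq_comm]

def Phi (o : V → V → K) (v : K → ℝ) : Matrix V V ℝ := Matrix.of fun x y => v (o x y)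

variable (R : Matrix V V ℝ) (o : V → V → K) (M : Matrix K K ℝ)

theorem phi_mul (hM : ∀ x y κ, ∑ z, (if o z y = κ then R x z else 0) = M (o x y) κ) (v : K → ℝ) :
    R * Phi o v = Phi o (M.mulVec v) := by
  ext x y
  simp only [Phi, Matrix.mul_apply, Matrix.of_apply, Matrix.mulVec, dotProduct, ← hM, Finset.sum_mul]
  rw [Finset.sum_comm]
  refine Finset.sum_congr rfl fun z _ => ?_
  simp [ite_mul]

theorem phi_aeval (hM : ∀ x y κ, ∑ z, (if o z y = κ then R x z else 0) = M (o x y) κ) (p : ℝ[X])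
    (v : K → ℝ) : aeval R p * Phi o v = Phi o ((aeval M p).mulVec v) := by
  have hadd : ∀ v w : K → ℝ, Phi o (v + w) = Phi o v + Phi o w := fun v w => by ext x y; simp [Phi]
  have hsm : ∀ (a : ℝ) (v : K → ℝ), Phi o (a • v) = a • Phi o v := fun v w => by ext x y; simp [Phi]
  induction p using Polynomial.induction_on' with
  | add p q hp hq => rw [map_add, add_mul, hp, hq, map_add, Matrix.add_mulVec, hadd]
  | monomial n a =>
    have : ∀ n, R ^ n * Phi o v = Phi o ((M ^ n).mulVec v) := by
      intro n
      induction n with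
      | zero => simp
      | succ n ih => rw [pow_succ', mul_assoc, ih, phi_mul R o M hM, pow_succ', Matrix.mulVec_mulVec]
    simp only [aeval_monomial, Algebra.algebraMap_eq_smul_one, smul_mul_assoc, one_mul, this,
      Matrix.smul_mulVec, hsm]

theorem phi_one (Δ : K → Prop) [DecidablePred Δ] (hΔ : ∀ x y, Δ (o x y) ↔ x = y) :
    Phi o (fun κ => if Δ κ then 1 else 0) = 1 := by
  ext x y
  simp [Phi, hΔ, Matrix.one_apply]

theorem eig_iff (hM : ∀ x y κ, ∑ z, (if o z y = κ then R x z else 0) = M (o x y) κ)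
    (Δ : K → Prop) [DecidablePred Δ] (hΔ : ∀ x y, Δ (o x y) ↔ x = y)
    (hsurj : ∀ κ, ∃ x y, o x y = κ) (μ : ℝ) :
    Module.End.HasEigenvalue (Matrix.toLin' R) μ ↔ M.charpoly.IsRoot μ := by
  constructor
  · intro h
    obtain ⟨u, hu⟩ := h.exists_hasEigenvector
    have h0 : aeval R M.charpoly = 0 := by
      have := phi_aeval R o M hM M.charpoly (fun κ => if Δ κ then 1 else 0)
      rw [phi_one o Δ hΔ, mul_one, Matrix.aeval_self_charpoly] at this
      rw [this]; ext; simp [Phi]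
    have h1 := Module.End.aeval_apply_of_hasEigenvector (p := M.charpoly) hu
    have h2 : aeval (Matrix.toLin' R) M.charpoly = 0 := by
      have := Polynomial.aeval_algHom_apply (Matrix.toLinAlgEquiv' (R := ℝ) (n := V)).toAlgHom R M.charpoly
      rw [h0, map_zero] at this
      exact this
    rw [h2] at h1
    simp only [LinearMap.zero_apply] at h1
    exact (smul_eq_zero.1 h1.symm).resolve_right hu.2
  · intro h
    have h1 : Module.End.HasEigenvalue (Matrix.toLin' M) μ := by
      rw [Module.End.hasEigenvalue_iff_isRoot_charpoly, Matrix.charpoly_toLin']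
      exact h
    obtain ⟨v, hv⟩ := h1.exists_hasEigenvector
    have hMv : M.mulVec v = μ • v := by simpa using hv.apply_eq_smul
    obtain ⟨κ, hκ⟩ := Function.ne_iff.1 hv.2
    obtain ⟨x, y, rfl⟩ := hsurj κ
    have h2 := phi_mul R o M hM v
    apply Module.End.hasEigenvalue_of_hasEigenvector (x := fun x => v (o x y))
    refine ⟨Module.End.mem_eigenspace_iff.2 ?_, fun h => hκ (congrFun h x)⟩
    funext x'
    have := congrFun (congrFun h2 x') y
    rw [hMv] at this
    simpa [Matrix.mul_apply, Phi, Matrix.mulVec, dotProduct] using this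

theorem trace_eq (hM : ∀ x y κ, ∑ z, (if o z y = κ then R x z else 0) = M (o x y) κ)
    (Δ : K → Prop) [DecidablePred Δ] (hΔ : ∀ x y, Δ (o x y) ↔ x = y) (p : ℝ[X]) :
    (aeval R p).trace = ∑ κ, (if Δ κ then (Nat.card {q : V × V | o q.1 q.2 = κ} : ℝ) *
      (aeval M p).mulVec (fun κ => if Δ κ then 1 else 0) κ else 0) := by
  have h1 := phi_aeval R o M hM p (fun κ => if Δ κ then 1 else 0)
  rw [phi_one o Δ hΔ, mul_one] at h1
  rw [h1]
  set v := (aeval M p).mulVec (fun κ => if Δ κ then 1 else 0)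
  have h2 : ∀ κ, Δ κ → Nat.card {q : V × V | o q.1 q.2 = κ} = ∑ x, if o x x = κ then 1 else 0 := by
    intro κ hκ
    rw [Finset.sum_boole, Nat.cast_id, ← Fintype.card_subtype, ← Nat.card_eq_fintype_card]
    refine Nat.card_congr ⟨fun q => ⟨q.1.1, ?_⟩, fun x => ⟨(x.1, x.1), x.2⟩, ?_, ?_⟩
    · obtain ⟨⟨x, y⟩, hq⟩ := q
      have : o x y = κ := hq
      have hxy : x = y := (hΔ x y).1 (this ▸ hκ)
      subst hxy
      exact this
    · rintro ⟨⟨x, y⟩, hq⟩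
      have : o x y = κ := hq
      have hxy : x = y := (hΔ x y).1 (this ▸ hκ)
      subst hxy
      rfl
    · intro x; rfl
  have h3 : ∀ κ, (if Δ κ then (Nat.card {q : V × V | o q.1 q.2 = κ} : ℝ) * v κ else 0)
      = ∑ x, if o x x = κ then v κ else 0 := by
    intro κ
    split_ifs with hκ
    · rw [h2 κ hκ]; push_cast; rw [Finset.sum_mul]; simp
    · symm
      apply Finset.sum_eq_zero
      intro x _
      rw [if_neg]
      rintro rfl
      exact hκ ((hΔ x x).2 rfl)
  simp only [h3]
  rw [Finset.sum_comm]
  simp [Matrix.trace, Phi]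

/-- the multiplicity formula -/
theorem mult_formula (hR : R.IsHermitian) (hM : ∀ x y κ, ∑ z, (if o z y = κ then R x z else 0) = M (o x y) κ)
    (Δ : K → Prop) [DecidablePred Δ] (hΔ : ∀ x y, Δ (o x y) ↔ x = y) {l : ℕ} (lam : Fin l → ℝ)
    (hinj : Function.Injective lam)
    (hlam : ∀ μ, Module.End.HasEigenvalue (Matrix.toLin' R) μ → ∃ i, lam i = μ) (i : Fin l) :
    (Module.finrank ℝ (Module.End.maxGenEigenspace (Matrix.toLin' R) (lam i)) : ℝ) =
    (∑ κ, (if Δ κ then (Nat.card {q : V × V | o q.1 q.2 = κ} : ℝ) *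
      (aeval M (∏ j ∈ Finset.univ.erase i, (X - C (lam j)))).mulVec (fun κ => if Δ κ then 1 else 0) κ else 0))
      / ∏ j ∈ Finset.univ.erase i, (lam i - lam j) := by
  rw [← trace_eq R o M hM Δ hΔ, trace_aeval R hR, mult_eq R hR]
  have hne : ∏ j ∈ Finset.univ.erase i, (lam i - lam j) ≠ 0 := by
    rw [Finset.prod_ne_zero_iff]
    intro j hj
    rw [sub_ne_zero]
    exact fun h => (Finset.mem_erase.1 hj).1 (hinj h.symm)
  rw [eq_div_iff hne]
  have : ∀ v, (∏ j ∈ Finset.univ.erase i, (X - C (lam j))).eval (hR.eigenvalues v) =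
      if hR.eigenvalues v = lam i then ∏ j ∈ Finset.univ.erase i, (lam i - lam j) else 0 := by
    intro v
    rw [Polynomial.eval_prod]
    simp only [eval_sub, eval_X, eval_C]
    split_ifs with h
    · rw [h]
    · have he : Module.End.HasEigenvalue (Matrix.toLin' R) (hR.eigenvalues v) := by
        rw [Module.End.hasEigenvalue_iff_isRoot_charpoly, Matrix.charpoly_toLin', hR.charpoly_eq,
          IsRoot, Polynomial.eval_prod]
        exact Finset.prod_eq_zero (Finset.mem_univ v) (by simp)
      obtain ⟨j, hj⟩ := hlam _ he
      apply Finset.prod_eq_zero (i := j)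
      · simp only [Finset.mem_erase, Finset.mem_univ, and_true]
        rintro rfl
        exact h hj.symm
      · rw [hj, sub_self]
  simp only [this]
  rw [← Finset.sum_filter, Finset.sum_const, nsmul_eq_mul]
end core
end S15

namespace S15
open Polynomial Filter Topology

/-- evaluation at t -/
noncomputable def evt (t : ℝ) : H →+* ℝ := (Pi.evalRingHom (fun _ : ℝ => ℝ) t).comp H.subtype

theorem evt_apply (t : ℝ) (f : H) : evt t f = f.1 t := rfl

theorem select {m : ℕ} (μ : Fin m → H) (hanti : ∀ᶠ t in atTop, Antitone fun i => (μ i).1 t) :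
    ∃ (l : ℕ) (lam : Fin l → H), ∀ᶠ t in atTop, StrictMono (fun i => (lam i).1 t) ∧
      ∀ x, (∃ i, (μ i).1 t = x) ↔ ∃ i, (lam i).1 t = x := by
  classical
  set reps : Finset (Fin m) := Finset.univ.filter fun i => ∀ j < i, ¬ (μ j).1 =ᶠ[atTop] (μ i).1 with hreps
  let e := reps.orderEmbOfFin rfl
  refine ⟨reps.card, fun i => μ (e i.rev), ?_⟩
  have hne : ∀ᶠ t in atTop, ∀ j, ∀ i ∈ reps, j < i → (μ j).1 t ≠ (μ i).1 t := by
    rw [eventually_all]; intro j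
    rw [Filter.eventually_all_finset]; intro i hi
    by_cases hji : j < i
    · rcases dich' (H.sub_mem (μ j).2 (μ i).2) with h | h
      · exfalso
        refine (Finset.mem_filter.1 hi).2 j hji ?_
        filter_upwards [h] with t ht
        exact sub_eq_zero.1 ht
      · filter_upwards [h] with t ht _
        exact sub_ne_zero.1 ht
    · exact Eventually.of_forall fun t h => absurd h hji
  have hrep : ∀ i, ∃ j ∈ reps, (μ j).1 =ᶠ[atTop] (μ i).1 := by
    intro i
    have hex : (Finset.univ.filter fun j => (μ j).1 =ᶠ[atTop] (μ i).1).Nonempty := ⟨i, by simp⟩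
    refine ⟨_, ?_, (Finset.mem_filter.1 (Finset.min'_mem _ hex)).2⟩
    rw [hreps, Finset.mem_filter]
    refine ⟨Finset.mem_univ _, fun j hj h => ?_⟩
    have h2 := (Finset.mem_filter.1 (Finset.min'_mem _ hex)).2
    have h4 : j ∈ Finset.univ.filter fun j => (μ j).1 =ᶠ[atTop] (μ i).1 :=
      Finset.mem_filter.2 ⟨Finset.mem_univ _, h.trans h2⟩
    have h3 := Finset.min'_le _ j h4
    exact absurd hj (not_lt.2 h3)
  choose g hg hge using hrep
  have hge' : ∀ᶠ t in atTop, ∀ i, (μ (g i)).1 t = (μ i).1 t := by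
    rw [eventually_all]; exact hge
  filter_upwards [hanti, hne, hge'] with t h1 h2 h3
  constructor
  · intro i j hij
    have h4 : e j.rev < e i.rev := e.lt_iff_lt.2 (Fin.rev_lt_rev.2 hij)
    exact lt_of_le_of_ne (h1 h4.le) (h2 _ _ (Finset.orderEmbOfFin_mem _ _ _) h4).symm
  · intro x
    constructor
    · rintro ⟨i, rfl⟩
      have hmem : g i ∈ Set.range e := by rw [Finset.range_orderEmbOfFin]; exact hg i
      obtain ⟨j, hj⟩ := hmem
      refine ⟨j.rev, ?_⟩
      simp only [Fin.rev_rev, hj, h3]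
    · rintro ⟨i, rfl⟩
      exact ⟨_, rfl⟩

theorem spec {k : ℕ} (M : Matrix (Fin k) (Fin k) H) (D : Fin k → H)
    (hD : ∀ κ, ∀ᶠ t in atTop, 0 < (D κ).1 t)
    (hM : ∀ κ κ', ∀ᶠ t in atTop, (D κ).1 t * (M κ κ').1 t = (D κ').1 t * (M κ' κ).1 t) :
    ∃ (l : ℕ) (lam : Fin l → H), ∀ᶠ t in atTop, StrictMono (fun i => (lam i).1 t) ∧
      ∀ x, (M.map (evt t)).charpoly.IsRoot x ↔ ∃ i, (lam i).1 t = x := by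
  have hcont : ∀ f : H, ∀ᶠ a in atTop, ContinuousOn f.1 (Set.Ioi a) := by
    intro f
    obtain ⟨⟨a, ha⟩, -⟩ := mem_H.1 f.2
    filter_upwards [eventually_ge_atTop a] with b hb using ha.mono (Set.Ioi_subset_Ioi hb)
  have e1 := eventually_all.2 fun κ => (eventually_forall_ge_atTop.2 (hD κ))
  have e2 := eventually_all.2 fun κ => eventually_all.2 fun κ' => (eventually_forall_ge_atTop.2 (hM κ κ'))
  have e3 := eventually_all.2 fun κ => hcont (D κ)
  have e4 := eventually_all.2 fun κ => eventually_all.2 fun κ' => hcont (M κ κ')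
  obtain ⟨a, h1, h2, h3, h4⟩ := (e1.and (e2.and (e3.and e4))).exists
  let S : Set.Ioi a → Matrix (Fin k) (Fin k) ℝ := fun t =>
    Matrix.of fun κ κ' => √((D κ).1 t) * ((M κ κ').1 t * (√((D κ').1 t))⁻¹)
  have hpos : ∀ t : Set.Ioi a, ∀ κ, 0 < √((D κ).1 t) := fun t κ => Real.sqrt_pos.2 (h1 κ t t.2.le)
  have hsq : ∀ t : Set.Ioi a, ∀ κ, √((D κ).1 t) * √((D κ).1 t) = (D κ).1 t := fun t κ =>
    Real.mul_self_sqrt (h1 κ t t.2.le).le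
  have hS : ∀ t, (S t).IsHermitian := by
    intro t
    ext κ κ'
    simp only [S, Matrix.conjTranspose_apply, Matrix.of_apply, star_trivial]
    have := h2 κ κ' t t.2.le
    have q1 := hsq t κ
    have q2 := hsq t κ'
    have p1 := hpos t κ
    have p2 := hpos t κ'
    field_simp
    rw [sq, sq, q1, q2]
    linarith
  have hD' : ∀ κ, Continuous fun t : Set.Ioi a => (D κ).1 t := fun κ =>
    continuousOn_iff_continuous_domRestrict.1 (h3 κ)
  have hM' : ∀ κ κ', Continuous fun t : Set.Ioi a => (M κ κ').1 t := fun κ κ' =>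
    continuousOn_iff_continuous_domRestrict.1 (h4 κ κ')
  have hSc : ∀ i j, Continuous fun t => S t i j := by
    intro i j
    refine (hD' i).sqrt.mul ((hM' i j).mul ((hD' j).sqrt.inv₀ fun t => (hpos t j).ne'))
  have hchar : ∀ t : Set.Ioi a, (S t).charpoly = (M.map (evt t)).charpoly := by
    intro t
    have : S t = Matrix.diagonal (fun κ => √((D κ).1 t)) * (M.map (evt t) *
        Matrix.diagonal (fun κ => (√((D κ).1 t))⁻¹)) := by
      ext κ κ'
      simp [S, Matrix.diagonal_mul, Matrix.mul_diagonal, evt_apply]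
    rw [this, Matrix.charpoly_mul_comm, mul_assoc, Matrix.diagonal_mul_diagonal]
    have h : (fun κ => (√((D κ).1 t))⁻¹ * √((D κ).1 t)) = fun _ => (1:ℝ) := by
      funext κ; exact inv_mul_cancel₀ (hpos t κ).ne'
    rw [h, Matrix.diagonal_one, mul_one]
  have hroot : ∀ (t : Set.Ioi a) x, (M.map (evt t)).charpoly.IsRoot x ↔ ∃ i, (hS t).eigenvalues₀ i = x := by
    intro t x
    rw [← hchar, ← Polynomial.mem_roots (Matrix.charpoly_monic _).ne_zero,
      (hS t).roots_charpoly_eq_eigenvalues₀]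
    simp only [Multiset.mem_map, Finset.mem_val, Finset.mem_univ, true_and, Function.comp_apply]
    rfl
  have hc := eig_cont S hS hSc
  let m : Fin (Fintype.card (Fin k)) → ℝ → ℝ := fun i t => if h : a < t then (hS ⟨t, h⟩).eigenvalues₀ i else 0
  have hm : ∀ (t : Set.Ioi a) i, m i t = (hS t).eigenvalues₀ i := fun t i => dif_pos t.2
  have hmem : ∀ i, m i ∈ H := by
    intro i
    refine mem_H.2 ⟨⟨a, ?_⟩, root_alg M.charpoly (Matrix.charpoly_monic _) _ ?_⟩
    · rw [continuousOn_iff_continuous_domRestrict]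
      refine ((continuous_apply i).comp hc).congr fun t => ?_
      exact (hm t i).symm
    · filter_upwards [eventually_gt_atTop a] with t ht
      have := (hroot ⟨t, ht⟩ (m i t)).2 ⟨i, (hm ⟨t, ht⟩ i).symm⟩
      rw [Matrix.charpoly_map] at this
      exact this
  obtain ⟨l, lam, h⟩ := select (fun i => (⟨m i, hmem i⟩ : H)) (by
    filter_upwards [eventually_gt_atTop a] with t ht i j hij
    change m j t ≤ m i t
    rw [hm ⟨t, ht⟩, hm ⟨t, ht⟩]
    exact (hS ⟨t, ht⟩).eigenvalues₀_antitone hij)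
  refine ⟨l, lam, ?_⟩
  filter_upwards [h, eventually_gt_atTop a] with t ht hta
  refine ⟨ht.1, fun x => ?_⟩
  rw [← ht.2, hroot ⟨t, hta⟩]
  simp only [← hm]

end S15

namespace S15
open Polynomial Filter Topology

theorem ev2_eq (n : ℕ) (z : ℝ) (P : ℚ[X][X]) : aeval z (P.map (evalRingHom (n : ℚ))) = ev2 n z P := by
  rw [aeval_def, eval₂_map, ev2]
  congr 1
  apply Polynomial.ringHom_ext
  · intro a; simp
  · simp

theorem H_pos_of_nat {f : ℝ → ℝ} (hf : f ∈ H) (h : ∀ᶠ n : ℕ in atTop, 0 < f n) :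
    ∀ᶠ t in atTop, 0 < f t := by
  rcases dich hf with h1 | h1 | h1
  · obtain ⟨n, h2, h3⟩ := (h.and (natTop h1)).exists
    exact absurd h3 h2.ne'
  · exact h1
  · obtain ⟨n, h2, h3⟩ := (h.and (natTop h1)).exists
    exact absurd h3 h2.le.not_gt

theorem H_eq_of_nat {f g : ℝ → ℝ} (hf : f ∈ H) (hg : g ∈ H) (h : ∀ᶠ n : ℕ in atTop, f n = g n) :
    ∀ᶠ t in atTop, f t = g t := by
  rcases dich' (H.sub_mem hf hg) with h1 | h1
  · filter_upwards [h1] with t ht using sub_eq_zero.1 ht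
  · obtain ⟨n, h2, h3⟩ := (h.and (natTop h1)).exists
    exact absurd (sub_eq_zero.2 h2) h3

theorem sym_of {V K : Type*} [Fintype V] [DecidableEq V] [Fintype K] [DecidableEq K]
    (R : Matrix V V ℝ) (hR : R.IsHermitian) (o : V → V → K) (M : Matrix K K ℝ)
    (hM : ∀ x y κ, ∑ z, (if o z y = κ then R x z else 0) = M (o x y) κ) (κ κ' : K) :
    (Nat.card {q : V × V | o q.1 q.2 = κ} : ℝ) * M κ κ' =
    (Nat.card {q : V × V | o q.1 q.2 = κ'} : ℝ) * M κ' κ := by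
  have key : ∀ κ κ', (Nat.card {q : V × V | o q.1 q.2 = κ} : ℝ) * M κ κ' =
      ∑ y, ∑ x, ∑ z, if o x y = κ then (if o z y = κ' then R x z else 0) else 0 := by
    intro κ κ'
    have h1 : (Nat.card {q : V × V | o q.1 q.2 = κ} : ℝ) = ∑ y, ∑ x, if o x y = κ then (1:ℝ) else 0 := by
      rw [Finset.sum_comm, ← Fintype.sum_prod_type', Nat.card_eq_fintype_card, Fintype.card_subtype,
        Finset.sum_boole]
      rfl
    rw [h1, Finset.sum_mul]
    refine Finset.sum_congr rfl fun y _ => ?_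
    rw [Finset.sum_mul]
    refine Finset.sum_congr rfl fun x _ => ?_
    split_ifs with h
    · rw [hM, h, one_mul]
    · simp
  rw [key, key]
  refine Finset.sum_congr rfl fun y _ => ?_
  rw [Finset.sum_comm]
  refine Finset.sum_congr rfl fun x _ => Finset.sum_congr rfl fun z _ => ?_
  have : R z x = R x z := by simpa using hR.apply x z
  rw [this]
  split_ifs <;> rfl

theorem evt_aeval {k : ℕ} (t : ℝ) (M : Matrix (Fin k) (Fin k) H) (p : Polynomial H) :
    (aeval M p).map (evt t) = aeval (M.map (evt t)) (p.map (evt t)) := by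
  have := Polynomial.map_aeval_eq_aeval_map (φ := evt t) (ψ := (evt t).mapMatrix (m := Fin k)) (by
    ext a i j
    by_cases hij : i = j <;> simp [Matrix.algebraMap_matrix_apply, hij]) p M
  exact this

theorem assemble {k : ℕ} (V : ℕ → Type) [∀ n, Fintype (V n)] [∀ n, DecidableEq (V n)]
    (R : ∀ n, Matrix (V n) (V n) ℝ) (hR : ∀ n, (R n).IsHermitian)
    (M : Matrix (Fin k) (Fin k) H) (D : Fin k → H) (Δ : Fin k → Prop) [DecidablePred Δ]
    (h : ∀ᶠ n : ℕ in atTop, ∃ o : V n → V n → Fin k,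
      (∀ x y κ, ∑ z, (if o z y = κ then R n x z else 0) = (M.map (evt n)) (o x y) κ) ∧
      (∀ x y, Δ (o x y) ↔ x = y) ∧ (∀ κ, ∃ x y, o x y = κ) ∧
      ∀ κ, (D κ).1 n = Nat.card {q : V n × V n | o q.1 q.2 = κ})
    (C d : ℕ) (hcard : ∀ᶠ n : ℕ in atTop, Fintype.card (V n) ≤ C * n ^ d) :
    ∃ (n₀ l : ℕ) (P : Fin l → Polynomial (Polynomial ℚ)) (q : Fin l → Polynomial ℚ),
      (∀ i, P i ≠ 0) ∧
      ∀ n : ℕ, n₀ ≤ n → ∃ lam : Fin l → ℝ,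
        StrictMono lam ∧
        (∀ μ : ℝ, Module.End.HasEigenvalue (Matrix.toLin' (R n)) μ ↔ ∃ i, lam i = μ) ∧
        (∀ i, Polynomial.aeval (lam i) ((P i).map (Polynomial.evalRingHom (n : ℚ))) = 0) ∧
        (∀ i, (q i).eval (n : ℚ) =
          (Module.finrank ℝ (Module.End.maxGenEigenspace (Matrix.toLin' (R n)) (lam i)) : ℚ)) := by
  obtain ⟨l, lam, hlam⟩ := spec M D (by
    intro κ
    apply H_pos_of_nat (D κ).2
    filter_upwards [h] with n ⟨o, _, _, h3, h4⟩
    rw [h4]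
    obtain ⟨x, y, hxy⟩ := h3 κ
    have h5 : 0 < Nat.card {q : V n × V n | o q.1 q.2 = κ} :=
      Nat.card_pos_iff.2 ⟨⟨⟨(x, y), hxy⟩⟩, inferInstance⟩
    exact_mod_cast h5) (by
    intro κ κ'
    refine H_eq_of_nat (f := (D κ).1 * (M κ κ').1) (g := (D κ').1 * (M κ' κ).1)
      (H.mul_mem (D κ).2 (M κ κ').2) (H.mul_mem (D κ').2 (M κ' κ).2) ?_
    filter_upwards [h] with n ⟨o, h1, h2, h3, h4⟩
    have := sym_of (R n) (hR n) o (M.map (evt n)) h1 κ κ'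
    rw [← h4, ← h4] at this
    exact this)
  choose P hP0 hP using fun i => (alg_iff (lam i).1).1 (mem_H.1 (lam i).2).2
  let num : Fin l → H := fun i => ∑ κ, (if Δ κ then D κ *
      (aeval M (∏ j ∈ Finset.univ.erase i, (X - Polynomial.C (lam j)))).mulVec (fun κ => if Δ κ then 1 else 0) κ else 0)
  let den : Fin l → H := fun i => ∏ j ∈ Finset.univ.erase i, (lam i - lam j)
  have hden : ∀ t i, (den i).1 t = ∏ j ∈ Finset.univ.erase i, ((lam i).1 t - (lam j).1 t) := by
    intro t i
    rw [← evt_apply, map_prod]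
    rfl
  have hnum : ∀ t i, (num i).1 t = ∑ κ, (if Δ κ then (D κ).1 t *
      (aeval (M.map (evt t)) (∏ j ∈ Finset.univ.erase i, (X - Polynomial.C ((lam j).1 t)))).mulVec
        (fun κ => if Δ κ then 1 else 0) κ else 0) := by
    intro t i
    rw [← evt_apply, map_sum]
    refine Finset.sum_congr rfl fun κ _ => ?_
    split_ifs
    · rw [map_mul, RingHom.map_mulVec, evt_aeval, Polynomial.map_prod]
      simp only [Polynomial.map_sub, Polynomial.map_X, Polynomial.map_C, evt_apply]
      congr 3
      funext κ
      simp only [Function.comp_apply]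
      split_ifs <;> simp
    · simp
  have hmem : ∀ i, (num i).1 / (den i).1 ∈ H := by
    intro i
    refine div_mem (num i).2 (den i).2 ?_
    filter_upwards [hlam] with t ht
    rw [hden, Finset.prod_ne_zero_iff]
    intro j hj
    rw [sub_ne_zero]
    exact fun h => (Finset.mem_erase.1 hj).1 (ht.1.injective h.symm)
  have hmain : ∀ᶠ n : ℕ in atTop, ∀ i, ((num i).1 / (den i).1) n =
      (Module.finrank ℝ (Module.End.maxGenEigenspace (Matrix.toLin' (R n)) ((lam i).1 n)) : ℝ) := by
    filter_upwards [h, natTop hlam] with n ⟨o, h1, h2, h3, h4⟩ hl i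
    rw [mult_formula (R n) o (M.map (evt n)) (hR n) h1 Δ h2 (fun i => (lam i).1 n) hl.1.injective
      (fun μ hμ => (hl.2 μ).1 ((eig_iff (R n) o (M.map (evt n)) h1 Δ h2 h3 μ).1 hμ)) i]
    simp only [Pi.div_apply, hnum, hden, h4]
  have hq : ∀ i, ∃ q : ℚ[X], ∀ᶠ n : ℕ in atTop, ((num i).1 / (den i).1) n = ((q.eval (n:ℚ) : ℚ) : ℝ) := by
    intro i
    refine intval d _ (hmem i) ?_ ⟨C, ?_⟩
    · filter_upwards [hmain] with n hn
      exact ⟨_, (hn i).trans (Int.cast_natCast _).symm⟩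
    · filter_upwards [hmain, hcard] with n hn hc
      rw [hn i, abs_of_nonneg (by positivity)]
      have := Submodule.finrank_le (Module.End.maxGenEigenspace (Matrix.toLin' (R n)) ((lam i).1 n))
      rw [Module.finrank_fintype_fun_eq_card] at this
      exact_mod_cast this.trans hc
  choose q hq using hq
  have hall : ∀ᶠ n : ℕ in atTop, ∃ lam : Fin l → ℝ,
        StrictMono lam ∧
        (∀ μ : ℝ, Module.End.HasEigenvalue (Matrix.toLin' (R n)) μ ↔ ∃ i, lam i = μ) ∧
        (∀ i, Polynomial.aeval (lam i) ((P i).map (Polynomial.evalRingHom (n : ℚ))) = 0) ∧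
        (∀ i, (q i).eval (n : ℚ) =
          (Module.finrank ℝ (Module.End.maxGenEigenspace (Matrix.toLin' (R n)) (lam i)) : ℚ)) := by
    filter_upwards [h, natTop hlam, hmain, eventually_all.2 hq,
      natTop (eventually_all.2 hP)] with n ⟨o, h1, h2, h3, h4⟩ hl hm hq hP
    refine ⟨fun i => (lam i).1 n, hl.1, fun μ => ?_, fun i => ?_, fun i => ?_⟩
    · rw [eig_iff (R n) o (M.map (evt n)) h1 Δ h2 h3 μ, hl.2]
    · rw [ev2_eq]; exact hP i
    · have := (hq i).symm.trans (hm i)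
      exact_mod_cast this
  obtain ⟨n₀, hn₀⟩ := eventually_atTop.1 hall
  exact ⟨n₀, l, P, q, hP0, hn₀⟩

theorem fiber_count (Y X : FISet) (hY : Y.FG) (hX : X.FG) {k N : ℕ} (w : Fin k → Y.obj N)
    (Q : ∀ n, Set ((Y.prod X).obj n)) (hQ : (Y.prod X).IsFISubset Q) :
    ∃ f : Fin k → H, ∀ᶠ n : ℕ in atTop, ∀ κ (g : Fin N ↪ Fin n),
      (Nat.card {z : X.obj n | (Y.map g (w κ), z) ∈ Q n} : ℝ) = (f κ).1 n := by
  classical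
  have key : ∀ κ, ∃ f : H, ∀ᶠ n : ℕ in atTop, ∀ (g : Fin N ↪ Fin n),
      (Nat.card {z : X.obj n | (Y.map g (w κ), z) ∈ Q n} : ℝ) = f.1 n := by
    intro κ
    let A : ∀ n, Set ((Y.prod X).obj n) := fun n => {p | p.1 ∈ orb Y (w κ) n ∧ p ∈ Q n}
    have hA : (Y.prod X).IsFISubset A := fun f x hx => ⟨orb_sub Y (w κ) f _ hx.1, hQ f x hx.2⟩
    have h1 := sub_count (Y.prod X) (prod_FG Y X hY hX) A hA
    have hpos : ∀ᶠ n : ℕ in atTop, (Nat.card (orb Y (w κ) n) : ℝ) ≠ 0 := by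
      filter_upwards [eventually_ge_atTop N] with n hn
      have : 0 < Nat.card (orb Y (w κ) n) :=
        Nat.card_pos_iff.2 ⟨⟨⟨_, Fin.castLEEmb hn, rfl⟩⟩, inferInstance⟩
      exact_mod_cast this.ne'
    obtain ⟨f, hf, hfn⟩ := h1.div (orb_count Y (w κ)) hpos
    refine ⟨⟨f, hf⟩, ?_⟩
    filter_upwards [hfn, hpos] with n hn hp g
    rw [← hn, eq_div_iff hp]
    have hc : ∀ g' : Fin N ↪ Fin n, Nat.card {z : X.obj n | (Y.map g' (w κ), z) ∈ Q n} =
        Nat.card {z : X.obj n | (Y.map g (w κ), z) ∈ Q n} := by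
      intro g'
      obtain ⟨σ, hσ⟩ := same_orbit Y g' g (w κ)
      refine Nat.card_congr (Equiv.subtypeEquiv (MulAction.toPerm σ) fun z => ?_)
      constructor
      · intro hz
        have := hQ σ.toEmbedding _ hz
        rw [← hσ]
        exact this
      · intro hz
        have := hQ (σ⁻¹ : Equiv.Perm (Fin n)).toEmbedding _ hz
        have h2 : (Y.prod X).map (σ⁻¹ : Equiv.Perm (Fin n)).toEmbedding
          ((Y.map g (w κ), (MulAction.toPerm σ) z) : Y.obj n × X.obj n) = (Y.map g' (w κ), z) := by
          rw [← hσ]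
          exact Prod.ext (inv_smul_smul σ (Y.map g' (w κ))) (inv_smul_smul σ z)
        rw [h2] at this
        exact this
    have e : A n ≃ Σ y : orb Y (w κ) n, {z : X.obj n | (y.1, z) ∈ Q n} :=
      ⟨fun p => ⟨⟨p.1.1, p.2.1⟩, ⟨p.1.2, p.2.2⟩⟩, fun s => ⟨(s.1.1, s.2.1), s.1.2, s.2.2⟩,
        fun _ => rfl, fun _ => rfl⟩
    rw [Nat.card_congr e, Nat.card_sigma]
    rw [Finset.sum_congr rfl (g := fun _ => Nat.card {z : X.obj n | (Y.map g (w κ), z) ∈ Q n})]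
    · simp only [Finset.sum_const, Finset.card_univ, smul_eq_mul, Nat.card_eq_fintype_card (α := orb Y (w κ) n)]
      push_cast
      ring
    · rintro ⟨y, g', rfl⟩ _
      exact hc g'
  choose f hf using key
  exact ⟨f, eventually_all.2 hf⟩

end S15

namespace S15
open Polynomial Filter Topology

theorem data (X : FISet) (hX : X.FG)
    (E : ∀ n, Set ((X.prod X).obj n)) (hE : (X.prod X).IsFISubset E) :
    ∃ (k : ℕ) (D : Fin k → H) (f1 : Fin k → Fin k → H) (f2 : Fin k → H) (Δ : Fin k → Prop),
    ∀ᶠ n : ℕ in atTop, ∃ o : X.obj n → X.obj n → Fin k,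
      (∀ x y κ', (Nat.card {z : X.obj n | o z y = κ' ∧ (x, z) ∈ E n} : ℝ) = (f1 κ' (o x y)).1 n) ∧
      (∀ x y, (Nat.card {z : X.obj n | (x, z) ∈ E n} : ℝ) = (f2 (o x y)).1 n) ∧
      (∀ x y, Δ (o x y) ↔ x = y) ∧ (∀ κ, ∃ x y, o x y = κ) ∧
      ∀ κ, (D κ).1 n = Nat.card {q : X.obj n × X.obj n | o q.1 q.2 = κ} := by
  have hY := prod_FG X X hX hX
  obtain ⟨k, N, w, hgen, hu⟩ := basis (X.prod X) hY
  have hD : ∀ κ, ∃ D : H, ∀ᶠ n : ℕ in atTop, (Nat.card (orb (X.prod X) (w κ) n) : ℝ) = D.1 n := by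
    intro κ
    obtain ⟨f, hf, hfn⟩ := orb_count (X.prod X) (w κ)
    exact ⟨⟨f, hf⟩, hfn⟩
  choose D hD using hD
  choose f1 hf1 using fun κ' => fiber_count (X.prod X) X hY hX w
    (fun n => {p | ((p.2, p.1.2) : (X.prod X).obj n) ∈ orb (X.prod X) (w κ') n ∧
      ((p.1.1, p.2) : (X.prod X).obj n) ∈ E n})
    (fun f x hx => ⟨orb_sub (X.prod X) (w κ') f _ hx.1, hE f _ hx.2⟩)
  obtain ⟨f2, hf2⟩ := fiber_count (X.prod X) X hY hX w
    (fun n => {p | ((p.1.1, p.2) : (X.prod X).obj n) ∈ E n})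
    (fun f x hx => hE f _ hx)
  obtain ⟨T, hT⟩ := sub_stable (X.prod X) w (fun n => {p | p.1 = p.2}) (by
    intro m n f x hx
    exact congrArg (X.map f) hx)
  refine ⟨k, D, f1, f2, fun κ => κ ∈ T, ?_⟩
  filter_upwards [eventually_all.2 hD, eventually_all.2 hf1, hf2, hT, eventually_ge_atTop N] with
    n hD hf1 hf2 hT hn
  choose o' g' ho' using hgen n hn
  let o : X.obj n → X.obj n → Fin k := fun x y => o' (x, y)
  let g : X.obj n → X.obj n → (Fin N ↪ Fin n) := fun x y => g' (x, y)
  have ho : ∀ x y, (X.prod X).map (g x y) (w (o x y)) = (x, y) := fun x y => ho' (x, y)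
  have hmem : ∀ x y κ, ((x, y) : (X.prod X).obj n) ∈ orb (X.prod X) (w κ) n ↔ o x y = κ := by
    intro x y κ
    constructor
    · rintro ⟨f, hf⟩
      exact hu n (g x y) f _ _ ((ho x y).trans hf.symm)
    · rintro rfl
      exact ⟨_, ho x y⟩
  refine ⟨o, ?_, ?_, ?_, ?_, ?_⟩
  · intro x y κ'
    rw [← hf1 κ' (o x y) (g x y), ho]
    refine congrArg Nat.cast (Nat.card_congr (Equiv.subtypeEquivRight fun z => ?_))
    exact and_congr_left' (hmem z y κ').symm
  · intro x y
    rw [← hf2 (o x y) (g x y), ho]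
    rfl
  · intro x y
    have := hT (o x y) (g x y)
    rw [ho] at this
    exact this.symm
  · intro κ
    let p := (X.prod X).map (Fin.castLEEmb hn) (w κ)
    exact ⟨p.1, p.2, (hmem p.1 p.2 κ).1 ⟨_, rfl⟩⟩
  · intro κ
    rw [← hD]
    refine congrArg Nat.cast (Nat.card_congr (Equiv.subtypeEquivRight ?_))
    rintro ⟨x, y⟩
    exact hmem x y κ

end S15

/-- **Statement 15** (Theorem H of [RW]): for a finitely generated `FI`-set `X` with a
symmetric `FI`-subset `E ⊆ X × X` (an `FI`-graph), and `r_n` either the adjacency operator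
or the Laplacian `D_n - A_n`, eventually: the number `l` of distinct (real) eigenvalues
`λ_1(n) < ⋯ < λ_l(n)` of `r_n` is constant, each `λ_i(n)` is a root of a fixed nonzero
`P_i ∈ ℚ[t][z]` evaluated at `t = n`, and the multiplicity of `λ_i(n)` agrees with a
polynomial `q_i ∈ ℚ[t]`. -/
theorem statement15 (X : FISet) (hX : X.FG)
    (E : ∀ n, Set ((X.prod X).obj n)) (hE : (X.prod X).IsFISubset E)
    (hsymm : ∀ (n : ℕ) (x y : X.obj n), (x, y) ∈ E n ↔ (y, x) ∈ E n)
    (r : ∀ n, Module.End ℝ (X.obj n → ℝ))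
    (hr : (∀ n, r n = adjEnd X E n) ∨ (∀ n, r n = degEnd X E n - adjEnd X E n)) :
    ∃ (n₀ l : ℕ) (P : Fin l → Polynomial (Polynomial ℚ)) (q : Fin l → Polynomial ℚ),
      (∀ i, P i ≠ 0) ∧
      ∀ n : ℕ, n₀ ≤ n → ∃ lam : Fin l → ℝ,
        StrictMono lam ∧
        (∀ μ : ℝ, (r n).HasEigenvalue μ ↔ ∃ i, lam i = μ) ∧
        (∀ i, Polynomial.aeval (lam i) ((P i).map (Polynomial.evalRingHom (n : ℚ))) = 0) ∧
        (∀ i, (q i).eval (n : ℚ) =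
          (Module.finrank ℝ ((r n).maxGenEigenspace (lam i)) : ℚ)) := by
  classical
  obtain ⟨k, D, f1, f2, Δ, hdata⟩ := S15.data X hX E hE
  obtain ⟨C, d, hcard⟩ := S15.card_bound X hX
  let A : ∀ n, Matrix (X.obj n) (X.obj n) ℝ := fun n => Matrix.of fun y x => if (x, y) ∈ E n then (1 : ℝ) else 0
  let G : ∀ n, Matrix (X.obj n) (X.obj n) ℝ := fun n =>
    Matrix.diagonal (fun x => (Nat.card {y : X.obj n | (x, y) ∈ E n} : ℝ))
  have hA : ∀ n, (A n).IsHermitian := by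
    intro n
    ext x y
    simp only [A, Matrix.conjTranspose_apply, Matrix.of_apply, star_trivial, hsymm n x y]
  have hG : ∀ n, (G n).IsHermitian := by
    intro n
    exact Matrix.isHermitian_diagonal _
  have hAsum : ∀ n (o : X.obj n → X.obj n → Fin k) x y κ, ∑ z, (if o z y = κ then A n x z else 0) =
      (Nat.card {z : X.obj n | o z y = κ ∧ (x, z) ∈ E n} : ℝ) := by
    intro n o x y κ
    rw [Nat.card_eq_fintype_card, Fintype.card_subtype, ← Finset.sum_boole]
    refine Finset.sum_congr rfl fun z _ => ?_
    simp only [A, Matrix.of_apply, Set.mem_ofPred_eq, hsymm n z x, ite_and]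
  rcases hr with hr | hr
  · have : r = fun n => Matrix.toLin' (A n) := funext hr
    subst this
    refine S15.assemble X.obj A hA (Matrix.of fun κ κ' => f1 κ' κ) D Δ ?_ C d hcard
    filter_upwards [hdata] with n ⟨o, h1, h2, h3, h4, h5⟩
    refine ⟨o, fun x y κ => ?_, h3, h4, h5⟩
    rw [hAsum, h1]
    rfl
  · have : r = fun n => Matrix.toLin' (G n - A n) := by
      funext n
      rw [map_sub]
      exact hr n
    subst this
    refine S15.assemble X.obj (fun n => G n - A n) (fun n => (hG n).sub (hA n))
      (Matrix.of fun κ κ' => (if κ = κ' then f2 κ else 0) - f1 κ' κ) D Δ ?_ C d hcard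
    filter_upwards [hdata] with n ⟨o, h1, h2, h3, h4, h5⟩
    refine ⟨o, fun x y κ => ?_, h3, h4, h5⟩
    have hs : ∀ z, (if o z y = κ then (G n - A n) x z else 0) =
        (if x = z then (if o z y = κ then G n x x else 0) else 0) - (if o z y = κ then A n x z else 0) := by
      intro z
      by_cases hxz : x = z
      · subst hxz
        rw [if_pos rfl]
        split_ifs <;> simp
      · rw [if_neg hxz]
        split_ifs <;> simp [hxz, G, Matrix.sub_apply]
    simp only [hs]
    rw [Finset.sum_sub_distrib, hAsum, h1, Finset.sum_ite_eq]
    simp only [Finset.mem_univ, if_true, Matrix.map_apply, Matrix.of_apply, map_sub, S15.evt_apply]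
    congr 1
    split_ifs with h
    · simp only [G, Matrix.diagonal_apply_eq]
      exact h2 x y
    · rfl
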